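/- arXiv:2104.12498 — 8 statements merged into one kernel-verified Lean document; each statement's English description precedes it below -/
import Mathlib

section
/- Let A be a Grothendieck abelian category which has exact products. Then the only cocompact object in the unbounded derived category D(A) is the zero object. -/
open CategoryTheory CategoryTheory.Limits CategoryTheory.Pretriangulated

universe v u

namespace Paper

variable {C : Type u} [Category.{v} C] [Preadditive C]

/-- The composite `X (n + k) ⟶ X n` of a downward sequence of morphisms. -/
def seqCompDown (X : ℕ → C) (f : ∀ n, X (n + 1) ⟶ X n) : ∀ n k, X (n + k) ⟶ X n
  | _, 0 => 𝟙 _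
  | n, (k + 1) => f (n + k) ≫ seqCompDown X f n k

/-- The composite `X n ⟶ X (n + k)` of an upward sequence of morphisms. -/
def seqCompUp (X : ℕ → C) (f : ∀ n, X n ⟶ X (n + 1)) : ∀ n k, X n ⟶ X (n + k)
  | _, 0 => 𝟙 _
  | n, (k + 1) => seqCompUp X f n k ≫ f (n + k)

/-- The morphism `∏ Xᵢ ⟶ ∏ Xᵢ` which is "1 minus the shift". -/
noncomputable def oneMinusShiftDown (X : ℕ → C) (f : ∀ n, X (n + 1) ⟶ X n)
    [HasProduct X] : (∏ᶜ X) ⟶ (∏ᶜ X) :=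
  Pi.lift fun n => Pi.π X n - (Pi.π X (n + 1) ≫ f n)

/-- The morphism `∐ Xᵢ ⟶ ∐ Xᵢ` which is "1 minus the shift". -/
noncomputable def oneMinusShiftUp (X : ℕ → C) (f : ∀ n, X n ⟶ X (n + 1))
    [HasCoproduct X] : (∐ X) ⟶ (∐ X) :=
  Sigma.desc fun n => Sigma.ι X n - (f n ≫ Sigma.ι X (n + 1))

variable [HasZeroObject C] [HasShift C ℤ] [∀ n : ℤ, (shiftFunctor C n).Additive]
  [Pretriangulated C]

/-- `H` is a homotopy limit of the sequence `⋯ → X₂ → X₁ → X₀` if it fits in a triangle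
`H → ∏ Xᵢ → ∏ Xᵢ → H⟦1⟧` whose middle morphism is 1 minus the shift. -/
def IsHolim (H : C) (X : ℕ → C) (f : ∀ n, X (n + 1) ⟶ X n) [HasProduct X] : Prop :=
  ∃ (a : H ⟶ ∏ᶜ X) (b : (∏ᶜ X) ⟶ H⟦(1 : ℤ)⟧),
    Triangle.mk a (oneMinusShiftDown X f) b ∈ distTriang C

/-- `H` is a homotopy colimit of the sequence `X₀ → X₁ → X₂ → ⋯` if it fits in a triangle
`∐ Xᵢ → ∐ Xᵢ → H → (∐ Xᵢ)⟦1⟧` whose first morphism is 1 minus the shift. -/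
def IsHocolim (H : C) (X : ℕ → C) (f : ∀ n, X n ⟶ X (n + 1)) [HasCoproduct X] : Prop :=
  ∃ (a : (∐ X) ⟶ H) (b : H ⟶ (∐ X)⟦(1 : ℤ)⟧),
    Triangle.mk (oneMinusShiftUp X f) a b ∈ distTriang C

/-- The colimit of the direct system `Hom(X₀, Y) → Hom(X₁, Y) → ⋯` vanishes. -/
def ColimHomZeroDown (X : ℕ → C) (f : ∀ n, X (n + 1) ⟶ X n) (Y : C) : Prop :=
  ∀ n (g : X n ⟶ Y), ∃ k, seqCompDown X f n k ≫ g = 0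

/-- The direct system `Hom(X₀, Y) → Hom(X₁, Y) → ⋯` is dual Mittag-Leffler: the increasing
chains of kernels stabilize. -/
def DualMLDown (X : ℕ → C) (f : ∀ n, X (n + 1) ⟶ X n) (Y : C) : Prop :=
  ∀ n, ∃ k, ∀ l (g : X n ⟶ Y),
    seqCompDown X f n (k + l) ≫ g = 0 → seqCompDown X f n k ≫ g = 0

/-- The colimit of the direct system `Hom(Y, X₀) → Hom(Y, X₁) → ⋯` vanishes. -/
def ColimHomZeroUp (Y : C) (X : ℕ → C) (f : ∀ n, X n ⟶ X (n + 1)) : Prop :=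
  ∀ n (g : Y ⟶ X n), ∃ k, g ≫ seqCompUp X f n k = 0

/-- The direct system `Hom(Y, X₀) → Hom(Y, X₁) → ⋯` is dual Mittag-Leffler. -/
def DualMLUp (Y : C) (X : ℕ → C) (f : ∀ n, X n ⟶ X (n + 1)) : Prop :=
  ∀ n, ∃ k, ∀ l (g : Y ⟶ X n),
    g ≫ seqCompUp X f n (k + l) = 0 → g ≫ seqCompUp X f n k = 0

/-- An object `Y` is `0`-cocompact if `Hom(holim 𝕋, Y) = 0` for every sequence
`𝕋 : ⋯ → T₂ → T₁ → T₀` such that `colim Hom(Tᵢ, Y) = 0` and `Hom(Tᵢ, Y⟦1⟧)` is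
dual Mittag-Leffler. -/
def IsZeroCocompact (Y : C) : Prop :=
  ∀ (X : ℕ → C) (f : ∀ n, X (n + 1) ⟶ X n) [HasProduct X],
    ColimHomZeroDown X f Y → DualMLDown X f (Y⟦(1 : ℤ)⟧) →
      ∀ H, IsHolim H X f → ∀ (h : H ⟶ Y), h = 0

/-- An object `Y` is `0`-compact if `Hom(Y, hocolim 𝕋) = 0` for every sequence
`𝕋 : T₀ → T₁ → T₂ → ⋯` such that `colim Hom(Y, Tᵢ) = 0` and `Hom(Y⟦1⟧, Tᵢ)` is
dual Mittag-Leffler. -/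
def IsZeroCompact (Y : C) : Prop :=
  ∀ (X : ℕ → C) (f : ∀ n, X n ⟶ X (n + 1)) [HasCoproduct X],
    ColimHomZeroUp Y X f → DualMLUp (Y⟦(1 : ℤ)⟧) X f →
      ∀ H, IsHocolim H X f → ∀ (h : Y ⟶ H), h = 0

end Paper

namespace Paper

variable {C : Type u} [Category.{v} C] [Preadditive C]

/-- The canonical map `⨁ᵢ Hom(Xᵢ, Y) → Hom(∏ Xᵢ, Y)`. -/
noncomputable def cocompactComparison {I : Type v} [DecidableEq I] (X : I → C) (Y : C)
    [HasProduct X] : (DirectSum I fun i => (X i ⟶ Y)) →+ ((∏ᶜ X) ⟶ Y) :=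
  DirectSum.toAddMonoid fun i => Preadditive.leftComp _ (Pi.π X i)

/-- An object `Y` is cocompact if for every set-indexed family `{Xᵢ}` the canonical map
`⨁ᵢ Hom(Xᵢ, Y) → Hom(∏ Xᵢ, Y)` is bijective. -/
def IsCocompact (Y : C) : Prop :=
  ∀ (I : Type v) [DecidableEq I] (X : I → C) [HasProduct X],
    Function.Bijective (cocompactComparison X Y)

/-- The canonical map `⨁ᵢ Hom(X, Yᵢ) → Hom(X, ∐ Yᵢ)`. -/
noncomputable def compactComparison {I : Type v} [DecidableEq I] (X : C) (Y : I → C)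
    [HasCoproduct Y] : (DirectSum I fun i => (X ⟶ Y i)) →+ (X ⟶ ∐ Y) :=
  DirectSum.toAddMonoid fun i => Preadditive.rightComp _ (Sigma.ι Y i)

/-- An object `X` is compact if for every set-indexed family `{Yᵢ}` the canonical map
`⨁ᵢ Hom(X, Yᵢ) → Hom(X, ∐ Yᵢ)` is bijective. -/
def IsCompactObject (X : C) : Prop :=
  ∀ (I : Type v) [DecidableEq I] (Y : I → C) [HasCoproduct Y],
    Function.Bijective (compactComparison X Y)

end Paper

section

universe w

namespace Paper

variable {A : Type u} [Category.{v} A] [Abelian A] {J : Type}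

/-- A family of cochain complexes, seen as a cochain complex of families. -/
@[simps]
noncomputable def familyComplex (S : J → CochainComplex A ℤ) :
    CochainComplex (Discrete J ⥤ A) ℤ where
  X i := Discrete.functor fun j => (S j).X i
  d i k := Discrete.natTrans fun j => (S j.as).d i k
  shape i k h := by
    ext j
    exact (S j.as).shape i k h
  d_comp_d' i k l _ _ := by
    ext j
    exact (S j.as).d_comp_d i k l

/-- The morphism of `familyComplex` induced by a family of morphisms. -/
@[simps]
noncomputable def familyMap {S T : J → CochainComplex A ℤ} (φ : ∀ j, S j ⟶ T j) :
    familyComplex S ⟶ familyComplex T where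
  f i := Discrete.natTrans fun j => (φ j.as).f i
  comm' i k _ := by
    ext j
    exact (φ j.as).comm i k

lemma isIso_map_homologyMap {B : Type*} [Category* B] [Abelian B] {S T : ShortComplex B}
    (ψ : S ⟶ T) (E : B ⥤ A) [E.PreservesZeroMorphisms] [E.PreservesHomology]
    [IsIso (ShortComplex.homologyMap (E.mapShortComplex.map ψ))] :
    IsIso (E.map (ShortComplex.homologyMap ψ)) := by
  have h : IsIso (ShortComplex.homologyMap (E.mapShortComplex.map ψ) ≫
      (ShortComplex.mapHomologyIso T E).hom) :=
    IsIso.comp_isIso' ‹_› (Iso.isIso_hom (T.mapHomologyIso E))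
  have hS : IsIso (S.mapHomologyIso E).hom := Iso.isIso_hom _
  exact @IsIso.of_isIso_fac_left _ _ _ _ _ _ _ _ hS h
    (ShortComplex.mapHomologyIso_hom_naturality ψ E).symm

lemma quasiIso_familyMap {S T : J → CochainComplex A ℤ} (φ : ∀ j, S j ⟶ T j)
    [∀ j, QuasiIso (φ j)] : QuasiIso (familyMap φ) where
  quasiIsoAt i := by
    rw [quasiIsoAt_iff_isIso_homologyMap, NatTrans.isIso_iff_isIso_app]
    intro j
    let E := (evaluation (Discrete J) A).obj j
    let ψ := (HomologicalComplex.shortComplexFunctor _ (ComplexShape.up ℤ) i).map (familyMap φ)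
    have h : IsIso (ShortComplex.homologyMap (E.mapShortComplex.map ψ)) :=
      inferInstanceAs (IsIso (HomologicalComplex.homologyMap (φ j.as) i))
    exact isIso_map_homologyMap ψ E

section Product

variable [HasProductsOfShape J A]

instance : (lim : (Discrete J ⥤ A) ⥤ A).Additive where
  map_add := by
    intros
    refine limit.hom_ext fun j => ?_
    simp

/-- The degreewise product of a family of cochain complexes. -/
noncomputable abbrev prodComplex (S : J → CochainComplex A ℤ) : CochainComplex A ℤ :=
  ((lim : (Discrete J ⥤ A) ⥤ A).mapHomologicalComplex _).obj (familyComplex S)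

/-- The projections of `prodComplex`. -/
noncomputable def prodπ (S : J → CochainComplex A ℤ) (j : J) : prodComplex S ⟶ S j where
  f i := limit.π (Discrete.functor fun j => (S j).X i) ⟨j⟩
  comm' i k _ := (limMap_π ((familyComplex S).d i k) ⟨j⟩).symm

/-- The morphism to `prodComplex` with given components. -/
noncomputable def prodLift {S : J → CochainComplex A ℤ} {Z : CochainComplex A ℤ}
    (φ : ∀ j, Z ⟶ S j) : Z ⟶ prodComplex S where
  f i := Pi.lift fun j => (φ j).f i
  comm' i k _ := by
    refine limit.hom_ext fun j => ?_
    refine (Category.assoc _ _ _).trans ((congrArg (_ ≫ ·) (limMap_π _ j)).trans ?_)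
    refine (limit.lift_π_assoc _ j _).trans (Eq.trans ?_ (Category.assoc _ _ _).symm)
    exact ((φ j.as).comm i k).trans (congrArg (_ ≫ ·) (Pi.lift_π (fun j => (φ j).f k) j.as).symm)

@[simp]
lemma prodLift_π {S : J → CochainComplex A ℤ} {Z : CochainComplex A ℤ}
    (φ : ∀ j, Z ⟶ S j) (j : J) : prodLift φ ≫ prodπ S j = φ j := by
  ext i
  exact Pi.lift_π _ _

lemma prod_hom_ext {S : J → CochainComplex A ℤ} {Z : CochainComplex A ℤ}
    {f g : Z ⟶ prodComplex S} (h : ∀ j, f ≫ prodπ S j = g ≫ prodπ S j) : f = g := by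
  ext i
  refine limit.hom_ext fun j => ?_
  exact congr_arg (fun φ => HomologicalComplex.Hom.f φ i) (h j.as)

/-- The functoriality of `prodComplex`. -/
noncomputable def prodMap {S T : J → CochainComplex A ℤ} (φ : ∀ j, S j ⟶ T j) :
    prodComplex S ⟶ prodComplex T :=
  ((lim : (Discrete J ⥤ A) ⥤ A).mapHomologicalComplex _).map (familyMap φ)

@[simp]
lemma prodMap_π {S T : J → CochainComplex A ℤ} (φ : ∀ j, S j ⟶ T j) (j : J) :
    prodMap φ ≫ prodπ T j = prodπ S j ≫ φ j := by
  ext i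
  exact limMap_π ((familyMap φ).f i) ⟨j⟩

instance [HasExactLimitsOfShape (Discrete J) A] {S T : J → CochainComplex A ℤ}
    (φ : ∀ j, S j ⟶ T j) [∀ j, QuasiIso (φ j)] : QuasiIso (prodMap φ) := by
  have := quasiIso_familyMap φ
  unfold prodMap
  infer_instance

variable [HasDerivedCategory.{w} A]

open DerivedCategory

lemma exists_prod_lift [HasExactLimitsOfShape (Discrete J) A] {S : J → CochainComplex A ℤ}
    {Z : DerivedCategory A} (f : ∀ j, Z ⟶ Q.obj (S j)) :
    ∃ g : Z ⟶ Q.obj (prodComplex S), ∀ j, g ≫ Q.map (prodπ S j) = f j := by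
  let e := Q.objObjPreimageIso Z
  choose T g s hs h using fun j => left_fac (e.hom ≫ f j)
  have (j : J) : QuasiIso (s j) := (isIso_Q_map_iff_quasiIso _ _).1 (hs j)
  refine ⟨e.inv ≫ Q.map (prodLift g) ≫ inv (Q.map (prodMap s)), fun j => ?_⟩
  rw [← cancel_epi e.hom, ← cancel_mono (Q.map (s j)), h]
  simp only [Category.assoc, Iso.hom_inv_id_assoc, IsIso.inv_hom_id, Category.comp_id]
  rw [← Q.map_comp, ← prodMap_π, Q.map_comp, IsIso.inv_hom_id_assoc, ← Q.map_comp, prodLift_π]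

/-- A morphism which vanishes in the derived category becomes null-homotopic after composition
with a quasi-isomorphism, hence factors through an acyclic complex depending only on its source. -/
lemma exists_fac_of_Q_map_eq_zero {K L : CochainComplex A ℤ} (φ : K ⟶ L) (h : Q.map φ = 0) :
    ∃ (M : CochainComplex A ℤ) (s : L ⟶ M) (_ : QuasiIso s)
      (k : HomologicalComplex.homotopyCofiber (𝟙 K) ⟶ M),
      φ ≫ s = HomologicalComplex.homotopyCofiber.inr (𝟙 K) ≫ k := by
  have h' : Qh.map ((HomotopyCategory.quotient _ _).map φ) = Qh.map 0 := by
    rw [← cancel_mono ((quotientCompQhIso A).hom.app L), quotientCompQhIso_hom_naturality, h]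
    simp
  rw [MorphismProperty.map_eq_iff_postcomp Qh (HomotopyCategory.quasiIso A _)] at h'
  obtain ⟨M, s, hs, fac⟩ := h'
  obtain ⟨M, rfl⟩ := HomotopyCategory.quotient_obj_surjective M
  obtain ⟨s, rfl⟩ := (HomotopyCategory.quotient _ _).map_surjective s
  rw [zero_comp, ← Functor.map_comp, HomotopyCategory.quotient_map_eq_zero_iff] at fac
  refine ⟨M, s, ?_, HomologicalComplex.homotopyCofiber.desc (𝟙 K) (φ ≫ s)
    ((Homotopy.ofEq (by simp)).trans fac.some), by simp⟩
  rwa [HomotopyCategory.quotient_map_mem_quasiIso_iff] at hs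

lemma prod_hom_ext_Q [HasExactLimitsOfShape (Discrete J) A] {S : J → CochainComplex A ℤ}
    {Z : DerivedCategory A} {f g : Z ⟶ Q.obj (prodComplex S)}
    (h : ∀ j, f ≫ Q.map (prodπ S j) = g ≫ Q.map (prodπ S j)) : f = g := by
  rw [← sub_eq_zero]
  replace h (j : J) : (f - g) ≫ Q.map (prodπ S j) = 0 := by
    rw [Preadditive.sub_comp, h, sub_self]
  generalize f - g = f at h
  let e := Q.objObjPreimageIso Z
  obtain ⟨K, s, hs, φ, hφ⟩ := right_fac (e.hom ≫ f)
  have h0 (j : J) : Q.map (φ ≫ prodπ S j) = 0 := by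
    rw [← cancel_epi (inv (Q.map s)), Q.map_comp, ← Category.assoc, ← hφ, Category.assoc, h]
    simp
  choose M t ht k hk using fun j => exists_fac_of_Q_map_eq_zero _ (h0 j)
  have fac : φ ≫ prodMap t = HomologicalComplex.homotopyCofiber.inr (𝟙 K) ≫ prodLift k :=
    prod_hom_ext fun j => by simpa using hk j
  have hz : Q.map (HomologicalComplex.homotopyCofiber.inr (𝟙 K)) = 0 := by
    have := Q_map_eq_of_homotopy A
      (HomologicalComplex.homotopyCofiber.inrCompHomotopy (𝟙 K) (fun j => ⟨j - 1, by simp⟩))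
    simpa using this
  have hφ0 : Q.map φ = 0 := by
    rw [← cancel_mono (Q.map (prodMap t)), ← Q.map_comp, fac, Q.map_comp, hz]
    simp
  rw [← cancel_epi e.hom, hφ, hφ0]
  simp

end Product


section Coproduct

variable [HasCoproductsOfShape J A]

instance : (colim : (Discrete J ⥤ A) ⥤ A).Additive where
  map_add := by
    intros
    refine colimit.hom_ext fun j => ?_
    simp

/-- The degreewise coproduct of a family of cochain complexes. -/
noncomputable abbrev coprodComplex (S : J → CochainComplex A ℤ) : CochainComplex A ℤ :=
  ((colim : (Discrete J ⥤ A) ⥤ A).mapHomologicalComplex _).obj (familyComplex S)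

/-- The inclusions of `coprodComplex`. -/
noncomputable def coprodι (S : J → CochainComplex A ℤ) (j : J) : S j ⟶ coprodComplex S where
  f i := colimit.ι (Discrete.functor fun j => (S j).X i) ⟨j⟩
  comm' i k _ := ι_colimMap ((familyComplex S).d i k) ⟨j⟩

/-- The morphism from `coprodComplex` with given components. -/
noncomputable def coprodDesc {S : J → CochainComplex A ℤ} {Z : CochainComplex A ℤ}
    (φ : ∀ j, S j ⟶ Z) : coprodComplex S ⟶ Z where
  f i := Sigma.desc fun j => (φ j).f i
  comm' i k _ := by
    refine colimit.hom_ext fun j => ?_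
    refine (Sigma.ι_desc_assoc (fun j => (φ j).f i) j.as _).trans (((φ j.as).comm i k).trans ?_)
    refine (congrArg (_ ≫ ·) (Sigma.ι_desc (fun j => (φ j).f k) j.as).symm).trans ?_
    exact (ι_colimMap_assoc ((familyComplex S).d i k) j _).symm

@[simp]
lemma ι_coprodDesc {S : J → CochainComplex A ℤ} {Z : CochainComplex A ℤ}
    (φ : ∀ j, S j ⟶ Z) (j : J) : coprodι S j ≫ coprodDesc φ = φ j := by
  ext i
  exact Sigma.ι_desc _ _

/-- The functoriality of `coprodComplex`. -/
noncomputable def coprodMap {S T : J → CochainComplex A ℤ} (φ : ∀ j, S j ⟶ T j) :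
    coprodComplex S ⟶ coprodComplex T :=
  ((colim : (Discrete J ⥤ A) ⥤ A).mapHomologicalComplex _).map (familyMap φ)

@[simp]
lemma ι_coprodMap {S T : J → CochainComplex A ℤ} (φ : ∀ j, S j ⟶ T j) (j : J) :
    coprodι S j ≫ coprodMap φ = φ j ≫ coprodι T j := by
  ext i
  exact ι_colimMap ((familyMap φ).f i) ⟨j⟩

instance [HasExactColimitsOfShape (Discrete J) A] {S T : J → CochainComplex A ℤ}
    (φ : ∀ j, S j ⟶ T j) [∀ j, QuasiIso (φ j)] : QuasiIso (coprodMap φ) := by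
  have := quasiIso_familyMap φ
  unfold coprodMap
  infer_instance

open DerivedCategory in
lemma exists_coprod_desc [HasDerivedCategory.{w} A] [HasExactColimitsOfShape (Discrete J) A]
    {S : J → CochainComplex A ℤ} {Z : DerivedCategory A} (f : ∀ j, Q.obj (S j) ⟶ Z) :
    ∃ g : Q.obj (coprodComplex S) ⟶ Z, ∀ j, Q.map (coprodι S j) ≫ g = f j := by
  let e := Q.objObjPreimageIso Z
  choose T s hs g h using fun j => right_fac (f j ≫ e.inv)
  have (j : J) : QuasiIso (s j) := (isIso_Q_map_iff_quasiIso _ _).1 (hs j)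
  refine ⟨inv (Q.map (coprodMap s)) ≫ Q.map (coprodDesc g) ≫ e.hom, fun j => ?_⟩
  rw [← cancel_mono e.inv, ← cancel_epi (Q.map (s j)), h]
  simp only [Category.assoc, Iso.hom_inv_id, IsIso.hom_inv_id_assoc, Category.comp_id]
  rw [← Q.map_comp_assoc, ← ι_coprodMap, Q.map_comp, Category.assoc, IsIso.hom_inv_id_assoc,
    ← Q.map_comp, ι_coprodDesc]

end Coproduct

lemma isIso_of_isZero_of_ne {C : Type u} [Category.{v} C] {X : J → C} [HasCoproduct X]
    [HasProduct X] {c : ∐ X ⟶ ∏ᶜ X} (h : ∀ j, Sigma.ι X j ≫ c ≫ Pi.π X j = 𝟙 _) (j₀ : J)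
    (hX : ∀ j, j ≠ j₀ → IsZero (X j)) : IsIso c := by
  refine ⟨Pi.π X j₀ ≫ Sigma.ι X j₀, Sigma.hom_ext _ _ fun j => ?_, Pi.hom_ext _ _ fun j => ?_⟩
  · by_cases hj : j = j₀
    · subst hj
      simpa using h j =≫ Sigma.ι X j
    · exact (hX j hj).eq_of_src _ _
  · by_cases hj : j = j₀
    · subst hj
      simp [h j]
    · exact (hX j hj).eq_of_tgt _ _

lemma mono_of_finite {C : Type u} [Category.{v} C] [Preadditive C] {I : Type*} [Finite I]
    {X : I → C} [HasCoproduct X] {Z : C} (m : ∐ X ⟶ Z) (p : ∀ i, Z ⟶ X i)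
    (h : ∀ i, Sigma.ι X i ≫ m ≫ p i = 𝟙 _) (h' : ∀ i k, i ≠ k → Sigma.ι X i ≫ m ≫ p k = 0) :
    Mono m := by
  have := Fintype.ofFinite I
  refine IsSplitMono.mono (hf := IsSplitMono.mk' ⟨∑ i, p i ≫ Sigma.ι X i, ?_⟩)
  refine Sigma.hom_ext _ _ fun i => ?_
  rw [Preadditive.comp_sum, Preadditive.comp_sum, Finset.sum_eq_single i]
  · simpa using h i =≫ Sigma.ι X i
  · intro k _ hk
    simpa using h' i k hk.symm =≫ Sigma.ι X k
  · simp

open CoproductsFromFiniteFiltered in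
lemma mono_of_ab5 [HasFilteredColimitsOfSize.{0, 0} A] [AB5OfSize.{0, 0} A] {X : J → A}
    [HasCoproduct X] [HasProduct X] {c : ∐ X ⟶ ∏ᶜ X}
    (h : ∀ j, Sigma.ι X j ≫ c ≫ Pi.π X j = 𝟙 _)
    (h' : ∀ j k, j ≠ k → Sigma.ι X j ≫ c ≫ Pi.π X k = 0) : Mono c := by
  let f : liftToFinsetObj (Discrete.functor X) ⟶
      (Functor.const (Finset (Discrete J))).obj (∏ᶜ X) :=
    { app I := (finiteSubcoproductsCocone X).ι.app I ≫ c
      naturality I I' φ := (Category.assoc _ _ _).symm.trans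
        ((congrArg (· ≫ c) ((finiteSubcoproductsCocone X).w φ)).trans (Category.comp_id _).symm) }
  have := IsFiltered.isConnected (Finset (Discrete J))
  refine (MorphismProperty.isStableUnderColimitsOfShape_monomorphisms
    A (Finset (Discrete J))).condition _ _ _ _
    (isColimitFiniteSubproductsCocone X) (isColimitConstCocone _ (∏ᶜ X)) f (fun I => ?_) c
    (fun I => (Category.comp_id _).symm)
  rw [MorphismProperty.monomorphisms.iff]
  have hf (i : I) {Z : A} (g : ∏ᶜ X ⟶ Z) : Sigma.ι (fun i : I => X i.1.as) i ≫ f.app I ≫ g =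
      Sigma.ι X i.1.as ≫ c ≫ g :=
    (congrArg (_ ≫ ·) (Category.assoc _ _ _)).trans (Sigma.ι_desc_assoc _ _ _)
  refine mono_of_finite (f.app I) (fun i => Pi.π X i.1.as)
    (fun i => (hf i _).trans (h i.1.as)) (fun i k hik => (hf i _).trans (h' i.1.as k.1.as ?_))
  exact fun e => hik (Subtype.ext (Discrete.ext e))

section SigmaToPi

variable [HasProductsOfShape J A] [HasCoproductsOfShape J A]

open Classical in
/-- The canonical morphism from the coproduct to the product of a family of complexes. -/
noncomputable def coprodToProd (S : J → CochainComplex A ℤ) : coprodComplex S ⟶ prodComplex S :=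
  coprodDesc fun j => prodLift fun k => if h : j = k then eqToHom (by rw [h]) else 0

lemma ι_coprodToProd_π_self (S : J → CochainComplex A ℤ) (j : J) :
    coprodι S j ≫ coprodToProd S ≫ prodπ S j = 𝟙 _ := by
  rw [coprodToProd, ← Category.assoc, ι_coprodDesc, prodLift_π]
  simp

lemma ι_coprodToProd_π_of_ne (S : J → CochainComplex A ℤ) {j k : J} (h : j ≠ k) :
    coprodι S j ≫ coprodToProd S ≫ prodπ S k = 0 := by
  rw [coprodToProd, ← Category.assoc, ι_coprodDesc, prodLift_π]
  simp [h]

lemma mono_coprodToProd [HasFilteredColimitsOfSize.{0, 0} A] [AB5OfSize.{0, 0} A]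
    (S : J → CochainComplex A ℤ) : Mono (coprodToProd S) := by
  have (i : ℤ) : Mono ((coprodToProd S).f i) :=
    mono_of_ab5 (X := fun j => (S j).X i)
      (fun j => congr_arg (fun φ => HomologicalComplex.Hom.f φ i) (ι_coprodToProd_π_self S j))
      (fun j k h => congr_arg (fun φ => HomologicalComplex.Hom.f φ i)
        (ι_coprodToProd_π_of_ne S h))
  exact HomologicalComplex.mono_of_mono_f _ this

lemma isIso_coprodToProd (S : J → CochainComplex A ℤ) (j₀ : ℤ → J)
    (hS : ∀ i j, j ≠ j₀ i → IsZero ((S j).X i)) : IsIso (coprodToProd S) := by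
  have (i : ℤ) : IsIso ((coprodToProd S).f i) :=
    isIso_of_isZero_of_ne (X := fun j => (S j).X i)
      (fun j => congr_arg (fun φ => HomologicalComplex.Hom.f φ i) (ι_coprodToProd_π_self S j))
      (j₀ i) (hS i)
  exact HomologicalComplex.Hom.isIso_of_components _

end SigmaToPi


section Cocompact

open DerivedCategory

lemma exists_finset_comp_cocompactComparison_eq_zero {C : Type u} [Category.{v} C] [Preadditive C]
    {I : Type v} [DecidableEq I] (X : I → C) (Y : C) [HasProduct X]
    (x : DirectSum I fun i => (X i ⟶ Y)) :
    ∃ s : Finset I, ∀ ⦃Z : C⦄ (t : Z ⟶ ∏ᶜ X), (∀ i ∈ s, t ≫ Pi.π X i = 0) →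
      t ≫ cocompactComparison X Y x = 0 := by
  induction x using DirectSum.induction_on with
  | zero => exact ⟨∅, fun Z t _ => by simp⟩
  | of i f =>
    refine ⟨{i}, fun Z t ht => ?_⟩
    have : cocompactComparison X Y (DirectSum.of _ i f) = Pi.π X i ≫ f :=
      DirectSum.toAddMonoid_of _ _ _
    rw [this, ← Category.assoc, ht i (Finset.mem_singleton_self i), zero_comp]
  | add x y hx hy =>
    obtain ⟨s, hs⟩ := hx
    obtain ⟨s', hs'⟩ := hy
    refine ⟨s ∪ s', fun Z t ht => ?_⟩
    rw [map_add, Preadditive.comp_add, hs t fun i hi => ht i (Finset.mem_union_left _ hi),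
      hs' t fun i hi => ht i (Finset.mem_union_right _ hi), add_zero]

variable [HasDerivedCategory.{w} A] [HasProductsOfShape ℕ A] [HasCoproductsOfShape ℕ A]
  [HasExactLimitsOfShape (Discrete ℕ) A] {Y : DerivedCategory A}

lemma exists_map_coprodι_comp_eq_zero (hY : IsCocompact Y) (S : ℕ → CochainComplex A ℤ)
    (g : Q.obj (prodComplex S) ⟶ Y) :
    ∃ n, Q.map (coprodι S n) ≫ Q.map (coprodToProd S) ≫ g = 0 := by
  let X (i : ULift.{w} ℕ) : DerivedCategory A := Q.obj (S i.down)
  choose l hl using fun s : Fan X => exists_prod_lift (S := S) fun n => s.proj ⟨n⟩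
  let c : Fan X := Fan.mk (Q.obj (prodComplex S)) fun i => Q.map (prodπ S i.down)
  let hc : IsLimit c := Fan.IsLimit.mk c l (fun s i => hl s i.down)
    fun s m hm => prod_hom_ext_Q fun n => (hm ⟨n⟩).trans (hl s n).symm
  have : HasProduct X := ⟨⟨c, hc⟩⟩
  let e : ∏ᶜ X ≅ Q.obj (prodComplex S) := (limit.isLimit _).conePointUniqueUpToIso hc
  have he (i : ULift.{w} ℕ) : e.inv ≫ Pi.π X i = Q.map (prodπ S i.down) :=
    IsLimit.conePointUniqueUpToIso_inv_comp (limit.isLimit _) hc ⟨i⟩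
  obtain ⟨x, hx⟩ := (hY _ X).surjective (e.hom ≫ g)
  obtain ⟨s, hs⟩ := exists_finset_comp_cocompactComparison_eq_zero X Y x
  obtain ⟨⟨n⟩, hn⟩ := Infinite.exists_notMem_finset s
  refine ⟨n, ?_⟩
  have := hs (Q.map (coprodι S n ≫ coprodToProd S) ≫ e.inv) fun i hi => by
    have hni : n ≠ i.down := by
      rintro rfl
      exact hn hi
    rw [Category.assoc, he, ← Q.map_comp, Category.assoc, ι_coprodToProd_π_of_ne S hni,
      Functor.map_zero]
  rw [hx] at this
  simpa using this

variable [HasExactColimitsOfShape (Discrete ℕ) A]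

lemma exists_single_succ_hom_ne_zero [HasFilteredColimitsOfSize.{0, 0} A] [AB5OfSize.{0, 0} A]
    (hY : IsCocompact Y) {d : ℤ} {X : A} {f : (singleFunctor A d).obj X ⟶ Y} (hf : f ≠ 0) :
    ∃ (X' : A) (f' : (singleFunctor A (d + 1)).obj X' ⟶ Y), f' ≠ 0 := by
  by_contra! H
  let S (_ : ℕ) : CochainComplex A ℤ := (HomologicalComplex.single A _ d).obj X
  obtain ⟨F, hF⟩ := exists_coprod_desc (S := S) fun _ => f
  have := mono_coprodToProd S
  let T := ShortComplex.mk (coprodToProd S) (cokernel.π _) (cokernel.condition _)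
  have hT : T.ShortExact := { exact := ShortComplex.exact_cokernel _ }
  have hz (i : ℤ) (hi : i ≠ d) : IsZero (T.X₃.X i) := by
    have : IsZero ((prodComplex S).X i) := by
      rw [IsZero.iff_id_eq_zero]
      exact limit.hom_ext fun j =>
        (HomologicalComplex.isZero_single_obj_X (ComplexShape.up ℤ) d X i hi).eq_of_tgt _ _
    exact IsZero.of_epi ((cokernel.π (coprodToProd S)).f i) this
  have : T.X₃.IsStrictlyGE d := by
    rw [CochainComplex.isStrictlyGE_iff]
    exact fun i hi => hz i hi.ne
  have : T.X₃.IsStrictlyLE d := by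
    rw [CochainComplex.isStrictlyLE_iff]
    exact fun i hi => hz i hi.ne'
  obtain ⟨M, ⟨e⟩⟩ := T.X₃.exists_iso_single d
  let e' : (Q.obj T.X₃)⟦(-1 : ℤ)⟧ ≅ (singleFunctor A (d + 1)).obj M :=
    (shiftFunctor _ (-1 : ℤ)).mapIso (Q.mapIso e) ≪≫
      ((singleFunctors A).shiftIso (-1) (d + 1) d (by lia)).app M
  have h0 (m : (Q.obj T.X₃)⟦(-1 : ℤ)⟧ ⟶ Y) : m = 0 := by
    rw [← cancel_epi e'.inv, comp_zero]
    exact H M _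
  obtain ⟨g, hg⟩ := Triangle.yoneda_exact₂ _
    (inv_rot_of_distTriang _ (triangleOfSES_distinguished hT)) F (h0 _)
  obtain ⟨n, hn⟩ := exists_map_coprodι_comp_eq_zero hY S g
  refine hf ((hF n).symm.trans (Eq.trans ?_ hn))
  rw [hg]
  rfl

lemma hom_single_eq_zero [HasFilteredColimitsOfSize.{0, 0} A] [AB5OfSize.{0, 0} A]
    (hY : IsCocompact Y) {d : ℤ} {X : A} (f : (singleFunctor A d).obj X ⟶ Y) : f = 0 := by
  by_contra hf
  have h (n : ℕ) : ∃ (X : A) (f : (singleFunctor A (d + n)).obj X ⟶ Y), f ≠ 0 := by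
    induction n with
    | zero =>
      rw [Nat.cast_zero, add_zero]
      exact ⟨X, f, hf⟩
    | succ n hn =>
      obtain ⟨X, f, hf⟩ := hn
      rw [Nat.cast_succ, ← add_assoc]
      exact exists_single_succ_hom_ne_zero hY hf
  choose X f hf using h
  let S (n : ℕ) : CochainComplex A ℤ := (HomologicalComplex.single A _ (d + n)).obj (X n)
  obtain ⟨F, hF⟩ := exists_coprod_desc (S := S) f
  have : IsIso (coprodToProd S) := isIso_coprodToProd S (fun i => (i - d).toNat) fun i n hn =>
    HomologicalComplex.isZero_single_obj_X _ _ _ _ (by lia)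
  obtain ⟨n, hn⟩ := exists_map_coprodι_comp_eq_zero hY S (inv (Q.map (coprodToProd S)) ≫ F)
  rw [IsIso.hom_inv_id_assoc, hF] at hn
  exact hf n hn

end Cocompact

section Detection

open DerivedCategory

variable [HasDerivedCategory.{w} A]

lemma isZero_homology_of_hom_single_eq_zero (K : CochainComplex A ℤ) (m : ℤ)
    (h : ∀ (X : A) (f : (singleFunctor A m).obj X ⟶ Q.obj K), f = 0) : IsZero (K.homology m) := by
  let φ : (HomologicalComplex.single A (ComplexShape.up ℤ) m).obj (K.cycles m) ⟶ K :=
    HomologicalComplex.mkHomFromSingle (K.iCycles m) (by simp)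
  have hφ : HomologicalComplex.homologyMap φ m = 0 := by
    have h0 : Q.map φ = 0 := h _ _
    have := NatIso.naturality_1 (homologyFunctorFactors A m) φ
    rw [Functor.comp_map, h0, (homologyFunctor A m).map_zero, zero_comp, comp_zero] at this
    exact this.symm
  let σ := (HomologicalComplex.singleObjCyclesSelfIso (ComplexShape.up ℤ) m (K.cycles m)).inv
  have hσ : σ ≫ HomologicalComplex.cyclesMap φ m = 𝟙 _ := by
    rw [← cancel_mono (K.iCycles m)]
    simp [σ, φ]
  have hπ : K.homologyπ m = 0 := by
    rw [← Category.id_comp (K.homologyπ m), ← hσ, Category.assoc,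
      ← HomologicalComplex.homologyπ_naturality, hφ]
    simp
  exact IsZero.of_epi_eq_zero _ hπ

lemma isZero_of_hom_single_eq_zero (Y : DerivedCategory A)
    (h : ∀ (m : ℤ) (X : A) (f : (singleFunctor A m).obj X ⟶ Y), f = 0) : IsZero Y := by
  let e := Q.objObjPreimageIso Y
  refine IsZero.of_iso ?_ e.symm
  have hK (m : ℤ) := isZero_homology_of_hom_single_eq_zero (Q.objPreimage Y) m fun X f => by
    rw [← cancel_mono e.hom, h m X (f ≫ e.hom), zero_comp]
  have : QuasiIso (0 : Q.objPreimage Y ⟶ Q.objPreimage Y) := ⟨fun m => by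
    rw [quasiIsoAt_iff_isIso_homologyMap]
    exact isIso_of_source_target_iso_zero _ (hK m).isoZero (hK m).isoZero⟩
  have := (isIso_Q_map_iff_quasiIso (C := A) _).2 this
  rw [Functor.map_zero] at this
  exact (IsZero.iff_id_eq_zero _).2 (isIsoZeroSelfEquiv _ this)

end Detection

end Paper

end

open Paper in
/-- Let `A` be a Grothendieck abelian category (abelian, AB5 with filtered
colimits, and with a separator) which has exact products.  Then the only cocompact object in
the unbounded derived category `D(A)` is the zero object. -/
theorem cocompact_in_derivedCategory_isZero
    {A : Type u} [Category.{v} A] [Abelian A]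
    [HasFilteredColimits A] [AB5 A] [HasSeparator A]
    [HasProducts.{v} A] [AB4Star A]
    [HasDerivedCategory.{w} A]
    (Y : DerivedCategory A) (hY : IsCocompact Y) :
    IsZero Y := by
  have := hasProducts_shrink.{0, v} (C := A)
  have : HasFilteredColimitsOfSize.{0, 0} A := hasFilteredColimitsOfSize_of_univLE.{0, 0, v, v}
  have : AB5OfSize.{0, 0} A := AB5OfSize_shrink.{0, 0, v, v} A
  have : HasCoproducts.{0} A := hasCoproducts_of_finite_and_filtered
  have := HasFiniteBiproducts.of_hasFiniteProducts (C := A)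
  have : AB4OfSize.{0} A := AB4.of_AB5 A
  have : AB4StarOfSize.{0} A := AB4StarOfSize_shrink.{0, v} A
  exact isZero_of_hom_single_eq_zero Y fun m X f => hom_single_eq_zero hY f
end

section
/- Let C be a cocompact object in a triangulated category T with countable products, and suppose C is a homotopy limit of a sequence ⋯ → C₂ → C₁ → C₀. Then C is a direct summand of a finite direct sum C₁ ⊕ ⋯ ⊕ Cₙ. -/
open CategoryTheory CategoryTheory.Limits CategoryTheory.Pretriangulated

universe v u

namespace Paper

section Preadditive

variable {C : Type u} [Category.{v} C] [Preadditive C]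

theorem IsCocompact.exists_eq_sum {Y : C} (hY : IsCocompact Y) {I : Type v} (X : I → C)
    [HasProduct X] (g : ∏ᶜ X ⟶ Y) :
    ∃ (s : Finset I) (h : ∀ i, X i ⟶ Y), g = ∑ i ∈ s, Pi.π X i ≫ h i := by
  classical
  obtain ⟨x, rfl⟩ := (hY I X).surjective g
  refine ⟨DFinsupp.support x, fun i => x i, ?_⟩
  conv_lhs => rw [← DirectSum.sum_support_of x]
  rw [map_sum]
  exact Finset.sum_congr rfl fun i _ => DirectSum.toAddMonoid_of _ _ _

/-- A morphism from a countable product to a cocompact object depends on only finitely many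
coordinates. -/
theorem IsCocompact.exists_eq_sum_range {Y : C} (hY : IsCocompact Y) {X : ℕ → C} {P : C}
    {p : ∀ i, P ⟶ X i} (hP : IsLimit (Fan.mk P p)) (g : P ⟶ Y) :
    ∃ (n : ℕ) (h : ∀ i, X i ⟶ Y), g = ∑ i ∈ Finset.range n, p i ≫ h i := by
  classical
  let X' : ULift.{v} ℕ → C := fun i => X i.down
  let hP' : IsLimit (Fan.mk P fun i => p i.down : Fan X') :=
    Fan.IsLimit.mk _ (fun t => Fan.IsLimit.lift hP fun i => t.proj ⟨i⟩)
      (fun t j => Fan.IsLimit.fac hP (fun i => t.proj ⟨i⟩) j.down)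
      fun t m hm => Fan.IsLimit.hom_ext hP _ _ fun i =>
        (hm ⟨i⟩).trans (Fan.IsLimit.fac hP (fun i => t.proj ⟨i⟩) i).symm
  have : HasProduct X' := ⟨⟨_, hP'⟩⟩
  let e : P ≅ ∏ᶜ X' := hP'.conePointUniqueUpToIso (limit.isLimit _)
  have he (i : ULift.{v} ℕ) : e.hom ≫ Pi.π X' i = p i.down :=
    hP'.conePointUniqueUpToIso_hom_comp (limit.isLimit _) ⟨i⟩
  obtain ⟨s, h, hg⟩ := hY.exists_eq_sum X' (e.inv ≫ g)
  have hg' : g = ∑ i ∈ s.map Equiv.ulift.toEmbedding, p i ≫ h ⟨i⟩ := by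
    rw [Iso.inv_comp_eq, Preadditive.comp_sum] at hg
    simp only [hg, Finset.sum_map, ← Category.assoc, he]
    rfl
  obtain ⟨n, hn⟩ := Finset.exists_nat_subset_range (s.map Equiv.ulift.toEmbedding)
  refine ⟨n, fun i => if i ∈ s.map Equiv.ulift.toEmbedding then h ⟨i⟩ else 0, ?_⟩
  rw [hg', ← Finset.sum_subset hn fun i _ hi => by beta_reduce; rw [if_neg hi, comp_zero]]
  exact Finset.sum_congr rfl fun i hi => by beta_reduce; rw [if_pos hi]

/-- Being injective on finite sums, "1 minus the shift" is left cancellable for morphisms which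
depend on only finitely many coordinates. -/
theorem sum_eq_zero_of_oneMinusShiftDown_comp {X : ℕ → C} {f : ∀ n, X (n + 1) ⟶ X n}
    [HasProduct X] {Y : C} {n : ℕ} {h : ∀ i, X i ⟶ Y}
    (hz : oneMinusShiftDown X f ≫ ∑ i ∈ Finset.range n, Pi.π X i ≫ h i = 0) :
    ∑ i ∈ Finset.range n, Pi.π X i ≫ h i = 0 := by
  classical
  have key (j : ℕ) : ∑ i ∈ Finset.range n,
      Pi.lift (Pi.single j (𝟙 (X j))) ≫ (Pi.π X i - Pi.π X (i + 1) ≫ f i) ≫ h i = 0 := by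
    have := Pi.lift (Pi.single j (𝟙 (X j))) ≫= hz
    simpa [oneMinusShiftDown, Preadditive.comp_sum] using this
  have hzero : ∀ j < n, h j = 0 := by
    intro j
    induction j with
    | zero =>
      intro hj
      have := key 0
      rw [Finset.sum_eq_single_of_mem 0 (Finset.mem_range.2 hj)] at this
      · simpa using this
      · intro i _ hi
        simp [hi]
    | succ j ih =>
      intro hj
      have := key (j + 1)
      rw [Finset.sum_eq_single_of_mem (j + 1) (Finset.mem_range.2 hj)] at this
      · simpa using this
      · intro i _ hi
        by_cases hij : i = j
        · rw [hij, ih (by omega), comp_zero, comp_zero]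
        · simp [hi, hij]
  exact Finset.sum_eq_zero fun i hi => by rw [hzero i (Finset.mem_range.1 hi), comp_zero]

end Preadditive

/-- A morphism from a countable product to a shift of a cocompact object depends on only finitely
many coordinates. -/
theorem IsCocompact.exists_eq_sum_range_shift {C : Type u} [Category.{v} C] [Preadditive C]
    [HasShift C ℤ] [∀ n : ℤ, (shiftFunctor C n).Additive] {Y : C} (hY : IsCocompact Y)
    {X : ℕ → C} [HasProduct X] (a : ℤ) (g : ∏ᶜ X ⟶ Y⟦a⟧) :
    ∃ (n : ℕ) (h : ∀ i, X i ⟶ Y⟦a⟧), g = ∑ i ∈ Finset.range n, Pi.π X i ≫ h i := by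
  let F := shiftFunctor C (-a)
  let e : F.obj (Y⟦a⟧) ≅ Y := shiftShiftNeg Y a
  obtain ⟨n, h, hg⟩ := hY.exists_eq_sum_range
    (isLimitFanMkObjOfIsLimit F X (Pi.π X) (productIsProduct X)) (F.map g ≫ e.hom)
  refine ⟨n, fun i => F.preimage (h i ≫ e.inv), F.map_injective ?_⟩
  rw [← Iso.eq_comp_inv] at hg
  simp [hg, Preadditive.sum_comp]

end Paper

open Paper in
/-- Let `C` be a cocompact object in a triangulated category `T` with
countable products, and suppose `C` is a homotopy limit of a sequence `⋯ → C₂ → C₁ → C₀`.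
Then `C` is a direct summand of a finite direct sum `C₀ ⊕ ⋯ ⊕ C_{n-1}`. -/
theorem cocompact_holim_is_summand_of_finite_sum
    {C : Type u} [Category.{v} C] [Preadditive C] [HasZeroObject C] [HasShift C ℤ]
    [∀ n : ℤ, (shiftFunctor C n).Additive] [Pretriangulated C] [HasCountableProducts C]
    (X : ℕ → C) (f : ∀ n, X (n + 1) ⟶ X n) (H : C)
    (hco : IsCocompact H) (hholim : IsHolim H X f) :
    ∃ (n : ℕ) (s : H ⟶ ∏ᶜ (fun i : Fin n => X i)) (r : (∏ᶜ (fun i : Fin n => X i)) ⟶ H),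
      s ≫ r = 𝟙 H := by
  obtain ⟨a, b, hT⟩ := hholim
  have hb : b = 0 := by
    obtain ⟨n, h, rfl⟩ := hco.exists_eq_sum_range_shift 1 b
    exact sum_eq_zero_of_oneMinusShiftDown_comp (comp_distTriang_mor_zero₂₃ _ hT)
  have : Mono a := Triangle.mono₁ _ hT hb
  have : IsSplitMono a := isSplitMono_of_mono a
  obtain ⟨n, h, hr⟩ := hco.exists_eq_sum_range (productIsProduct X) (retraction a)
  refine ⟨n, a ≫ Pi.lift fun i => Pi.π X i, ∑ i, Pi.π _ i ≫ h i, ?_⟩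
  rw [← IsSplitMono.id a, hr, Finset.sum_range]
  simp [Preadditive.comp_sum]
end

section
/- Let {Xᵢ} be a set-indexed collection of 0-cocompact objects in a triangulated category T with set-indexed products. Then the product ∏ᵢ Xᵢ is 0-cocompact. -/
open CategoryTheory CategoryTheory.Limits CategoryTheory.Pretriangulated

universe v u

namespace Paper

variable {C : Type u} [Category.{v} C] [Preadditive C]

/-- The vanishing of `colim Hom(Xₙ, -)` passes to retracts. -/
lemma ColimHomZeroDown.of_retract {X : ℕ → C} {f : ∀ n, X (n + 1) ⟶ X n} {Y Z : C}
    (hY : ColimHomZeroDown X f Y) (r : Retract Z Y) : ColimHomZeroDown X f Z := by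
  intro n g
  obtain ⟨k, hk⟩ := hY n (g ≫ r.i)
  exact ⟨k, by simpa using hk =≫ r.r⟩

/-- The dual Mittag-Leffler property of `Hom(Xₙ, -)` passes to retracts. -/
lemma DualMLDown.of_retract {X : ℕ → C} {f : ∀ n, X (n + 1) ⟶ X n} {Y Z : C}
    (hY : DualMLDown X f Y) (r : Retract Z Y) : DualMLDown X f Z := by
  intro n
  obtain ⟨k, hk⟩ := hY n
  refine ⟨k, fun l g hg => ?_⟩
  have hgi := hk l (g ≫ r.i) (by rw [reassoc_of% hg, zero_comp])
  simpa using hgi =≫ r.r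

end Paper

open Paper in
/-- Let `{Xᵢ}` be a set-indexed collection of `0`-cocompact objects in a
triangulated category `T` with set-indexed products. Then the product `∏ᵢ Xᵢ` is
`0`-cocompact. -/
theorem product_of_zeroCocompact_isZeroCocompact
    {C : Type u} [Category.{v} C] [Preadditive C] [HasZeroObject C] [HasShift C ℤ]
    [∀ n : ℤ, (shiftFunctor C n).Additive] [Pretriangulated C] [HasProducts.{v} C]
    {I : Type v} (X : I → C) (hX : ∀ i, IsZeroCocompact (X i)) :
    IsZeroCocompact (∏ᶜ X) := by
  intro T f _ hcolim hML H hH h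
  refine Pi.hom_ext _ _ fun i => ?_
  let r : Retract (X i) (∏ᶜ X) := ⟨section_ (Pi.π X i), Pi.π X i, IsSplitEpi.id _⟩
  rw [zero_comp]
  exact hX i T f (hcolim.of_retract r) (hML.of_retract (r.map (shiftFunctor C (1 : ℤ)))) H hH _
end

section
/- Let F : T' → T be a triangle functor between triangulated categories with countable products, admitting a right adjoint G. If F preserves countable products, then G preserves 0-cocompact objects. If moreover F reflects zero objects, then G takes any set of 0-cocompact cogenerators for T to a set of 0-cocompact cogenerators for T'. -/
open CategoryTheory CategoryTheory.Limits CategoryTheory.Pretriangulated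

universe v u

namespace Paper

variable {C : Type u} [Category.{v} C] [Preadditive C] [HasZeroObject C] [HasShift C ℤ]
  [∀ n : ℤ, (shiftFunctor C n).Additive] [Pretriangulated C]

/-- A set `S` of objects cogenerates `T` if the only object all of whose shifts admit only
zero morphisms to members of `S` is the zero object. -/
def Cogenerates (S : Set C) : Prop :=
  ∀ T : C, (∀ (n : ℤ) (s : C), s ∈ S → ∀ φ : T⟦n⟧ ⟶ s, φ = 0) → IsZero T

end Paper

namespace Paper

lemma map_seqCompDown {C' : Type*} [Category* C'] {C : Type*} [Category* C] (F : C' ⥤ C)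
    (X : ℕ → C') (f : ∀ n, X (n + 1) ⟶ X n) (n k : ℕ) :
    F.map (seqCompDown X f n k) =
      seqCompDown (fun i => F.obj (X i)) (fun i => F.map (f i)) n k := by
  induction k with
  | zero => simp [seqCompDown]
  | succ k ih => simp [seqCompDown, ih]

section

variable {C' : Type*} [Category* C'] [Preadditive C'] {C : Type*} [Category* C] [Preadditive C]

lemma map_oneMinusShiftDown_comp_piComparison (F : C' ⥤ C) [F.Additive] (X : ℕ → C')
    (f : ∀ n, X (n + 1) ⟶ X n) [HasProduct X] [HasProduct fun i => F.obj (X i)] :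
    F.map (oneMinusShiftDown X f) ≫ piComparison F X =
      piComparison F X ≫ oneMinusShiftDown (fun i => F.obj (X i)) (fun i => F.map (f i)) := by
  refine Pi.hom_ext _ _ fun n => ?_
  simp [oneMinusShiftDown, ← Functor.map_comp, Preadditive.comp_sub]

lemma seqCompDown_comp_homEquiv_eq_zero_iff {F : C' ⥤ C} {G : C ⥤ C'} [F.Additive] (adj : F ⊣ G)
    (X : ℕ → C') (f : ∀ n, X (n + 1) ⟶ X n) {Y : C} (n k : ℕ) (g : F.obj (X n) ⟶ Y) :
    seqCompDown X f n k ≫ adj.homEquiv _ _ g = 0 ↔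
      seqCompDown (fun i => F.obj (X i)) (fun i => F.map (f i)) n k ≫ g = 0 := by
  rw [← adj.homEquiv_naturality_left, map_seqCompDown, ← adj.homAddEquiv_apply,
    EmbeddingLike.map_eq_zero_iff]

lemma ColimHomZeroDown.map_of_adjunction {F : C' ⥤ C} {G : C ⥤ C'} [F.Additive] (adj : F ⊣ G)
    {X : ℕ → C'} {f : ∀ n, X (n + 1) ⟶ X n} {Y : C} (h : ColimHomZeroDown X f (G.obj Y)) :
    ColimHomZeroDown (fun i => F.obj (X i)) (fun i => F.map (f i)) Y := fun n g =>
  (h n (adj.homEquiv _ _ g)).imp fun k hk =>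
    (seqCompDown_comp_homEquiv_eq_zero_iff adj X f n k g).1 hk

lemma DualMLDown.map_of_adjunction {F : C' ⥤ C} {G : C ⥤ C'} [F.Additive] (adj : F ⊣ G)
    {X : ℕ → C'} {f : ∀ n, X (n + 1) ⟶ X n} {Y : C} (h : DualMLDown X f (G.obj Y)) :
    DualMLDown (fun i => F.obj (X i)) (fun i => F.map (f i)) Y := fun n =>
  (h n).imp fun k hk l g hg =>
    (seqCompDown_comp_homEquiv_eq_zero_iff adj X f n k g).1
      (hk l _ ((seqCompDown_comp_homEquiv_eq_zero_iff adj X f n (k + l) g).2 hg))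

lemma DualMLDown.of_iso {X : ℕ → C} {f : ∀ n, X (n + 1) ⟶ X n} {Y Y' : C} (e : Y ≅ Y')
    (h : DualMLDown X f Y) : DualMLDown X f Y' := fun n =>
  (h n).imp fun k hk l g hg => by
    simpa [← Category.assoc] using hk l (g ≫ e.inv) (by rw [reassoc_of% hg, zero_comp])

lemma Cogenerates.image_of_adjunction [HasShift C' ℤ] [HasShift C ℤ] {F : C' ⥤ C}
    {G : C ⥤ C'} [F.CommShift ℤ] [F.Additive]
    (adj : F ⊣ G) (hF : ∀ X : C', IsZero (F.obj X) → IsZero X) {S : Set C} (hS : Cogenerates S) :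
    Cogenerates (G.obj '' S) := by
  intro T hT
  refine hF T (hS _ fun n s hs φ => ?_)
  have := hT n _ ⟨s, hs, rfl⟩ (adj.homEquiv _ _ ((F.commShiftIso n).hom.app T ≫ φ))
  rw [← adj.homAddEquiv_apply, EmbeddingLike.map_eq_zero_iff] at this
  rwa [← cancel_epi ((F.commShiftIso n).hom.app T), comp_zero]

end

section

variable {C' : Type*} [Category* C'] [Preadditive C'] [HasZeroObject C'] [HasShift C' ℤ]
  [∀ n : ℤ, (shiftFunctor C' n).Additive] [Pretriangulated C']
  {C : Type*} [Category* C] [Preadditive C] [HasZeroObject C] [HasShift C ℤ]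
  [∀ n : ℤ, (shiftFunctor C n).Additive] [Pretriangulated C]

lemma IsHolim.map (F : C' ⥤ C) [F.CommShift ℤ] [F.IsTriangulated] {H : C'} {X : ℕ → C'}
    {f : ∀ n, X (n + 1) ⟶ X n} [HasProduct X] [HasProduct fun i => F.obj (X i)]
    [PreservesLimit (Discrete.functor X) F] (h : IsHolim H X f) :
    IsHolim (F.obj H) (fun i => F.obj (X i)) (fun i => F.map (f i)) := by
  obtain ⟨a, b, hT⟩ := h
  let e := PreservesProduct.iso F X
  have he : oneMinusShiftDown (fun i => F.obj (X i)) (fun i => F.map (f i)) ≫ e.inv =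
      e.inv ≫ F.map (oneMinusShiftDown X f) := by
    rw [Iso.comp_inv_eq, Category.assoc, Iso.eq_inv_comp]
    exact (map_oneMinusShiftDown_comp_piComparison F X f).symm
  refine ⟨F.map a ≫ e.hom, e.inv ≫ F.map b ≫ (F.commShiftIso (1 : ℤ)).hom.app H,
    isomorphic_distinguished _ (F.map_distinguished _ hT) _
      (Triangle.isoMk _ _ (Iso.refl _) e.symm e.symm ?_ he ?_)⟩
  · change (F.map a ≫ e.hom) ≫ e.inv = 𝟙 _ ≫ F.map a
    simp
  · change (e.inv ≫ F.map b ≫ (F.commShiftIso (1 : ℤ)).hom.app H) ≫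
      (shiftFunctor C (1 : ℤ)).map (𝟙 (F.obj H)) =
        e.inv ≫ F.map b ≫ (F.commShiftIso (1 : ℤ)).hom.app H
    simp

lemma IsZeroCocompact.map_of_adjunction {F : C' ⥤ C} {G : C ⥤ C'} [F.CommShift ℤ]
    [F.IsTriangulated] [HasCountableProducts C] [PreservesLimitsOfShape (Discrete ℕ) F]
    (adj : F ⊣ G) {Y : C} (hY : IsZeroCocompact Y) : IsZeroCocompact (G.obj Y) := by
  intro X f _ hcolim hML H hH h
  let := adj.rightAdjointCommShift ℤ
  refine (adj.homEquiv _ _).symm.injective ?_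
  rw [hY _ _ (hcolim.map_of_adjunction adj)
    ((hML.of_iso ((G.commShiftIso (1 : ℤ)).app Y).symm).map_of_adjunction adj) _ (hH.map F)
    ((adj.homEquiv _ _).symm h)]
  simp [Adjunction.homEquiv_counit]

end

end Paper

open Paper in
/-- Let `F : T' → T` be a triangle functor between triangulated categories
with countable products, admitting a right adjoint `G`.  If `F` preserves countable products,
then `G` preserves `0`-cocompact objects.  If moreover `F` reflects zero objects, then `G`
takes any set of `0`-cocompact cogenerators for `T` to a set of `0`-cocompact cogenerators
for `T'`. -/
theorem rightAdjoint_preserves_zeroCocompact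
    {C' : Type u'} [Category.{v'} C'] [Preadditive C'] [HasZeroObject C'] [HasShift C' ℤ]
    [∀ n : ℤ, (shiftFunctor C' n).Additive] [Pretriangulated C'] [HasCountableProducts C']
    {C : Type u} [Category.{v} C] [Preadditive C] [HasZeroObject C] [HasShift C ℤ]
    [∀ n : ℤ, (shiftFunctor C n).Additive] [Pretriangulated C] [HasCountableProducts C]
    (F : C' ⥤ C) (G : C ⥤ C') [F.CommShift ℤ] [F.IsTriangulated]
    (adj : F ⊣ G)
    (hF : ∀ (J : Type) [Countable J], PreservesLimitsOfShape (Discrete J) F) :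
    (∀ Y : C, IsZeroCocompact Y → IsZeroCocompact (G.obj Y)) ∧
    ((∀ X : C', IsZero (F.obj X) → IsZero X) →
      ∀ S : Set C, (∀ Y ∈ S, IsZeroCocompact Y) → Cogenerates S →
        (∀ Y ∈ S, IsZeroCocompact (G.obj Y)) ∧ Cogenerates (G.obj '' S)) := by
  have := hF ℕ
  have h (Y : C) (hY : IsZeroCocompact Y) : IsZeroCocompact (G.obj Y) :=
    hY.map_of_adjunction adj
  exact ⟨h, fun hF₀ S hS hcog =>
    ⟨fun Y hY => h Y (hS Y hY), hcog.image_of_adjunction adj hF₀⟩⟩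
end

section
/- Let T be a triangulated k-category with set-indexed products and coproducts. If X, Y ∈ T satisfy a natural isomorphism T(X, −)* ≅ T(−, Y) of functors on T, then X is compact and Y is 0-cocompact. -/
open CategoryTheory CategoryTheory.Limits CategoryTheory.Pretriangulated

universe v u

namespace Paper

variable (k : Type v) [CommRing k] (I : Type v) [AddCommGroup I] [Module k I]
variable {C : Type u} [Category.{v} C] [Preadditive C] [CategoryTheory.Linear k C]

open CategoryTheory

/-- `I` is a cogenerator of `Mod k`: every nonzero element of a `k`-module is detected by a
linear form with values in `I`. -/
def IsCogenerator : Prop :=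
  ∀ (M : Type v) [AddCommGroup M] [Module k M] (m : M), m ≠ 0 → ∃ φ : M →ₗ[k] I, φ m ≠ 0

/-- The data exhibiting `SX` as a partial Serre dual of `X` with respect to the duality
`(-)* = Hom_k(-, I)`: a family of `k`-linear isomorphisms `Hom(X,T)* ≅ Hom(T, SX)`
which is natural in `T`. -/
structure SerreDualityData (X SX : C) where
  equiv : ∀ T : C, ((X ⟶ T) →ₗ[k] I) ≃ₗ[k] (T ⟶ SX)
  naturality : ∀ {T T' : C} (f : T ⟶ T') (φ : (X ⟶ T') →ₗ[k] I),
    equiv T (φ.comp (Linear.rightComp k X f)) = f ≫ equiv T' φ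

end Paper

namespace Paper

section InverseSystem

variable {G : ℕ → Type*} [∀ n, AddCommGroup (G n)] (u : ∀ n, G (n + 1) →+ G n)

/-- The image in `G n` of the `k`-fold composite of transition maps of an inverse system. -/
def iterImage : ℕ → ∀ n, AddSubgroup (G n)
  | 0, _ => ⊤
  | k + 1, n => (iterImage k (n + 1)).map (u n)

/-- The partial sum `g n + u (g (n + 1)) + ⋯` with `k` terms. -/
def partialSum (g : ∀ n, G n) : ℕ → ∀ n, G n
  | 0, _ => 0
  | k + 1, n => g n + u n (partialSum g k (n + 1))

lemma iterImage_succ_le (k n : ℕ) : iterImage u (k + 1) n ≤ iterImage u k n := by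
  induction k generalizing n with
  | zero => exact le_top
  | succ k ih => exact AddSubgroup.map_mono (ih (n + 1))

lemma iterImage_antitone (n : ℕ) : Antitone fun k => iterImage u k n :=
  antitone_nat_of_succ_le fun k => iterImage_succ_le u k n

lemma partialSum_succ_sub_mem (g : ∀ n, G n) (k n : ℕ) :
    partialSum u g (k + 1) n - partialSum u g k n ∈ iterImage u k n := by
  induction k generalizing n with
  | zero => exact AddSubgroup.mem_top _
  | succ k ih =>
    refine ⟨_, ih (n + 1), ?_⟩
    rw [map_sub]
    exact (add_sub_add_left_eq_sub _ _ (g n)).symm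

lemma partialSum_sub_mem (g : ∀ n, G n) {k l : ℕ} (h : k ≤ l) (n : ℕ) :
    partialSum u g l n - partialSum u g k n ∈ iterImage u k n := by
  induction l, h using Nat.le_induction with
  | base => simp
  | succ l h ih =>
    have := add_mem (iterImage_antitone u n h (partialSum_succ_sub_mem u g l n)) ih
    rwa [sub_add_sub_cancel] at this

/-- The derived limit of a Mittag-Leffler inverse system of abelian groups vanishes. -/
lemma exists_sub_eq_of_mittagLeffler
    (hML : ∀ n, ∃ k, ∀ l, iterImage u k n ≤ iterImage u (k + l) n) (g : ∀ n, G n) :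
    ∃ x : ∀ n, G n, ∀ n, x n - u n (x (n + 1)) = g n := by
  choose κ hκ using hML
  obtain ⟨K, hK, hκK⟩ : ∃ K : ℕ → ℕ, Monotone K ∧ ∀ n, κ n ≤ K n :=
    ⟨partialSups κ, (partialSups κ).monotone, le_partialSups κ⟩
  have hstable (n m : ℕ) : iterImage u (K n) n ≤ iterImage u m n :=
    (iterImage_antitone u n (hκK n)).trans
      ((hκ n m).trans (iterImage_antitone u n (Nat.le_add_left _ _)))
  let t : ∀ n, G n := fun n =>
    partialSum u g (K (n + 1) + 1) n - partialSum u g (K n) n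
  have ht (n : ℕ) : t n ∈ iterImage u (K n) n :=
    partialSum_sub_mem u g ((hK n.le_succ).trans (Nat.le_succ _)) n
  have hlift (n : ℕ) (y : iterImage u (K n) n) :
      ∃ z : iterImage u (K (n + 1)) (n + 1), u n z = (y : G n) - t n := by
    obtain ⟨z, hz, hzy⟩ := hstable n (K (n + 1) + 1) (sub_mem y.2 (ht n))
    exact ⟨⟨z, hz⟩, hzy⟩
  choose next hnext using hlift
  let y : ∀ n, iterImage u (K n) n := fun n => Nat.rec 0 next n
  refine ⟨fun n => partialSum u g (K n) n + (y n).1, fun n => ?_⟩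
  have hy : u n (y (n + 1)) = (y n).1 - t n := hnext n _
  rw [map_add, hy]
  simp only [t, partialSum]
  abel

end InverseSystem

/-- A cogenerator separates points from submodules. -/
lemma IsCogenerator.exists_le_ker {k : Type v} [CommRing k] {I : Type v} [AddCommGroup I]
    [Module k I] (hcog : IsCogenerator k I) {M : Type v} [AddCommGroup M] [Module k M]
    (N : Submodule k M) {m : M} (hm : m ∉ N) :
    ∃ φ : M →ₗ[k] I, N ≤ LinearMap.ker φ ∧ φ m ≠ 0 := by
  obtain ⟨φ, hφ⟩ := hcog (M ⧸ N) (N.mkQ m) (by simpa using hm)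
  exact ⟨φ.comp N.mkQ, fun x hx => by simp [(Submodule.Quotient.mk_eq_zero N).2 hx], hφ⟩

section Sequences

variable {C : Type u} [Category.{v} C] (X : ℕ → C) (f : ∀ n, X (n + 1) ⟶ X n)

lemma seqCompDown_succ_eq (n k : ℕ) :
    seqCompDown X f n (k + 1) =
      eqToHom (by rw [Nat.add_right_comm, Nat.add_assoc]) ≫ seqCompDown X f (n + 1) k ≫ f n := by
  have hf {a b : ℕ} (h : a = b) :
      f a ≫ eqToHom (by rw [h]) = eqToHom (by rw [h]) ≫ f b := by
    subst h; simp
  induction k with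
  | zero => simp [seqCompDown]
  | succ k ih =>
    rw [seqCompDown, ih, ← Category.assoc, hf (show n + (k + 1) = n + 1 + k by omega)]
    simp [seqCompDown]

lemma comp_seqCompDown_of_compatible {Z : C} (x : ∀ n, Z ⟶ X n)
    (hx : ∀ n, x (n + 1) ≫ f n = x n) (n k : ℕ) :
    x (n + k) ≫ seqCompDown X f n k = x n := by
  induction k with
  | zero => simp [seqCompDown]
  | succ k ih => rw [seqCompDown, ← Category.assoc, ← ih]; congr 1; exact hx (n + k)

lemma mem_iterImage_iff [Preadditive C] {Z : C} (k n : ℕ) (y : Z ⟶ X n) :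
    y ∈ iterImage (G := fun n => (Z ⟶ X n)) (fun n => Preadditive.rightComp Z (f n)) k n ↔
      ∃ z : Z ⟶ X (n + k), z ≫ seqCompDown X f n k = y := by
  induction k generalizing n with
  | zero => exact ⟨fun _ => ⟨y, by simp [seqCompDown]⟩, fun _ => AddSubgroup.mem_top _⟩
  | succ k ih =>
    have e : X (n + 1 + k) = X (n + (k + 1)) := by rw [Nat.add_right_comm, Nat.add_assoc]
    constructor
    · rintro ⟨w, hw, rfl⟩
      obtain ⟨z, rfl⟩ := (ih (n + 1) w).1 hw
      exact ⟨z ≫ eqToHom e, by simp [seqCompDown_succ_eq, Preadditive.rightComp]⟩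
    · rintro ⟨z, rfl⟩
      refine ⟨(z ≫ eqToHom e.symm) ≫ seqCompDown X f (n + 1) k, (ih (n + 1) _).2 ⟨_, rfl⟩, ?_⟩
      simp [seqCompDown_succ_eq, Preadditive.rightComp]

end Sequences

namespace SerreDualityData

variable {k : Type v} [CommRing k] {I : Type v} [AddCommGroup I] [Module k I]
  {C : Type u} [Category.{v} C] [Preadditive C] [CategoryTheory.Linear k C] {X Y : C}

lemma comp_equiv_eq_zero_iff (D : SerreDualityData k I X Y) {T T' : C} (f : T ⟶ T')
    (φ : (X ⟶ T') →ₗ[k] I) : f ≫ D.equiv T' φ = 0 ↔ ∀ g : X ⟶ T, φ (g ≫ f) = 0 := by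
  rw [← D.naturality, LinearEquiv.map_eq_zero_iff, LinearMap.ext_iff]
  rfl

/-- An object with a partial Serre dual is compact. -/
lemma isCompactObject (D : SerreDualityData k I X Y) (hcog : IsCogenerator k I) :
    IsCompactObject X := by
  intro J _ Z _
  have hof (i : J) (g : X ⟶ Z i) :
      compactComparison X Z (DirectSum.of _ i g) = g ≫ Sigma.ι Z i :=
    DirectSum.toAddMonoid_of _ _ _
  constructor
  · rw [injective_iff_map_eq_zero]
    intro x hx
    have hproj (i : J) (x : DirectSum J fun i => (X ⟶ Z i)) :
        compactComparison X Z x ≫ Sigma.desc (Pi.single i (𝟙 (Z i)) : ∀ j, Z j ⟶ Z i) = x i := by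
      induction x using DirectSum.induction_on with
      | zero => simp
      | of j g =>
        rw [hof]
        by_cases h : j = i
        · subst h; simp
        · simp [h, DirectSum.of_eq_of_ne _ _ _ (Ne.symm h)]
      | add a b ha hb => simp [ha, hb]
    ext i
    rw [← hproj i x, hx]
    simp
  · intro z
    by_contra hz
    have hmem : z ∉ ⨆ i, LinearMap.range (Linear.rightComp k X (Sigma.ι Z i)) := by
      intro hmem
      refine hz (Submodule.iSup_induction _
        (motive := fun z => ∃ x, compactComparison X Z x = z) hmem ?_ ⟨0, map_zero _⟩ ?_)
      · rintro i _ ⟨g, rfl⟩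
        exact ⟨_, hof i g⟩
      · rintro _ _ ⟨a, rfl⟩ ⟨b, rfl⟩
        exact ⟨a + b, map_add _ _ _⟩
    obtain ⟨φ, hφ, hne⟩ := hcog.exists_le_ker _ hmem
    have h0 : D.equiv _ φ = 0 := by
      refine Sigma.hom_ext _ _ fun i => ?_
      rw [comp_zero, D.comp_equiv_eq_zero_iff]
      exact fun g => hφ (Submodule.mem_iSup_of_mem i ⟨g, rfl⟩)
    rw [LinearEquiv.map_eq_zero_iff] at h0
    exact hne (by simp [h0])

lemma eq_zero_of_compatible (D : SerreDualityData k I X Y) (hcog : IsCogenerator k I)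
    {T : ℕ → C} {f : ∀ n, T (n + 1) ⟶ T n} (hT : ColimHomZeroDown T f Y)
    (x : ∀ n, X ⟶ T n) (hx : ∀ n, x (n + 1) ≫ f n = x n) (n : ℕ) : x n = 0 := by
  by_contra hne
  obtain ⟨φ, hφ⟩ := hcog _ _ hne
  obtain ⟨m, hm⟩ := hT n (D.equiv _ φ)
  rw [D.comp_equiv_eq_zero_iff] at hm
  exact hφ (by rw [← comp_seqCompDown_of_compatible T f x hx n m, hm])

variable [HasShift C ℤ] [∀ n : ℤ, (shiftFunctor C n).Additive]

lemma mittagLeffler_of_dualMLDown (D : SerreDualityData k I X Y) (hcog : IsCogenerator k I)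
    {T : ℕ → C} {f : ∀ n, T (n + 1) ⟶ T n} (hT : DualMLDown T f (Y⟦(1 : ℤ)⟧)) (n : ℕ) :
    letI u : ∀ n, (X⟦(1 : ℤ)⟧ ⟶ T (n + 1)) →+ (X⟦(1 : ℤ)⟧ ⟶ T n) :=
      fun n => Preadditive.rightComp (X⟦(1 : ℤ)⟧) (f n)
    ∃ m, ∀ l, iterImage (G := fun n => (X⟦(1 : ℤ)⟧ ⟶ T n)) u m n ≤
      iterImage (G := fun n => (X⟦(1 : ℤ)⟧ ⟶ T n)) u (m + l) n := by
  let adj : shiftFunctor C (1 : ℤ) ⊣ shiftFunctor C (-1 : ℤ) := (shiftEquiv C (1 : ℤ)).toAdjunction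
  let adj' : shiftFunctor C (-1 : ℤ) ⊣ shiftFunctor C (1 : ℤ) :=
    (shiftEquiv C (1 : ℤ)).symm.toAdjunction
  obtain ⟨m, hm⟩ := hT n
  refine ⟨m, fun l y hy => ?_⟩
  rw [mem_iterImage_iff] at hy ⊢
  obtain ⟨z, rfl⟩ := hy
  by_contra hnot
  have hmem : adj.homEquiv _ _ (z ≫ seqCompDown T f n m) ∉
      LinearMap.range (Linear.rightComp k X ((seqCompDown T f n (m + l))⟦(-1 : ℤ)⟧')) := by
    rintro ⟨w, hw⟩
    refine hnot ⟨(adj.homEquiv _ _).symm w, ?_⟩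
    rw [← adj.homEquiv_naturality_right_symm, Equiv.symm_apply_eq]
    exact hw
  obtain ⟨φ, hφ, hne⟩ := hcog.exists_le_ker _ hmem
  have hiff (j : ℕ) : seqCompDown T f n j ≫ adj'.homEquiv _ _ (D.equiv _ φ) = 0 ↔
      ∀ g, φ (g ≫ (seqCompDown T f n j)⟦(-1 : ℤ)⟧') = 0 := by
    have h0 : adj'.homEquiv (T (n + j)) Y 0 = 0 := by simp [Adjunction.homEquiv_unit]
    rw [← D.comp_equiv_eq_zero_iff, ← adj'.homEquiv_naturality_left, ← h0,
      EmbeddingLike.apply_eq_iff_eq]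
  refine hne ?_
  rw [adj.homEquiv_naturality_right]
  exact (hiff m).1 (hm l _ ((hiff (m + l)).2 fun g => hφ ⟨g, rfl⟩)) _

/-- A partial Serre dual is `0`-cocompact. -/
lemma isZeroCocompact [HasZeroObject C] [Pretriangulated C] (D : SerreDualityData k I X Y)
    (hcog : IsCogenerator k I) : IsZeroCocompact Y := by
  intro T f _ hcolim hML H ⟨a, b, hdist⟩ h
  have hzero (x : X ⟶ H) : x = 0 := by
    have hxa : x ≫ a = 0 := by
      refine Pi.hom_ext _ _ fun n => ?_
      rw [zero_comp]
      refine D.eq_zero_of_compatible hcog hcolim (fun n => (x ≫ a) ≫ Pi.π T n) (fun n => ?_) n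
      have h0 : a ≫ oneMinusShiftDown T f = 0 := comp_distTriang_mor_zero₁₂ _ hdist
      have := x ≫= (h0 =≫ Pi.π T n)
      simp only [oneMinusShiftDown, Category.assoc, Pi.lift_π, Preadditive.comp_sub, zero_comp,
        comp_zero, sub_eq_zero] at this ⊢
      exact this.symm
    have hxa' : x⟦(1 : ℤ)⟧' ≫ a⟦(1 : ℤ)⟧' = 0 := by rw [← Functor.map_comp, hxa, Functor.map_zero]
    obtain ⟨g, hg⟩ : ∃ g : X⟦(1 : ℤ)⟧ ⟶ ∏ᶜ T, x⟦(1 : ℤ)⟧' = g ≫ b :=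
      Triangle.coyoneda_exact₁ _ hdist (x⟦(1 : ℤ)⟧') hxa'
    obtain ⟨w, hw⟩ := exists_sub_eq_of_mittagLeffler (G := fun n => (X⟦(1 : ℤ)⟧ ⟶ T n)) _
      (D.mittagLeffler_of_dualMLDown hcog hML) fun n => g ≫ Pi.π T n
    have hgw : g = Pi.lift w ≫ oneMinusShiftDown T f := by
      refine Pi.hom_ext _ _ fun n => ?_
      rw [← hw n]
      simp [oneMinusShiftDown, Preadditive.rightComp]
    have hb : oneMinusShiftDown T f ≫ b = 0 := comp_distTriang_mor_zero₂₃ _ hdist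
    apply (shiftFunctor C (1 : ℤ)).map_injective
    rw [Functor.map_zero, hg, hgw, Category.assoc, hb, comp_zero]
  obtain ⟨φ, rfl⟩ := (D.equiv H).surjective h
  rw [LinearEquiv.map_eq_zero_iff]
  ext x
  simp [hzero x]

end SerreDualityData

end Paper

open Paper in
/-- Let `T` be a triangulated `k`-category with set-indexed products and
coproducts.  If `X, Y ∈ T` satisfy a natural isomorphism `Hom(X,-)* ≅ Hom(-,Y)`, then `X` is
compact and `Y` is `0`-cocompact. -/
theorem serreDualPair_compact_and_zeroCocompact
    (k : Type v) [CommRing k] (I : Type v) [AddCommGroup I] [Module k I]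
    [Module.Injective k I] (hcog : IsCogenerator k I)
    {C : Type u} [Category.{v} C] [Preadditive C] [CategoryTheory.Linear k C]
    [HasZeroObject C] [HasShift C ℤ] [∀ n : ℤ, (shiftFunctor C n).Additive]
    [Pretriangulated C] [HasProducts.{v} C] [HasCoproducts.{v} C]
    (X Y : C) (D : SerreDualityData k I X Y) :
    IsCompactObject X ∧ IsZeroCocompact Y := by
  exact ⟨D.isCompactObject hcog, D.isZeroCocompact hcog⟩
end

section
/- Let T be an idempotent complete triangulated k-category and S : X → T a partial Serre functor. Let X ∈ X have local endomorphism ring, and let I_X be an injective envelope of the simple End(X)-module. Then: (1) the functor Hom_{End(X)}(T(X, −), I_X) is representable, so there is an almost split triangle τX → M → X → τX[1]; and (2) this almost split triangle is a direct summand of the triangle S X[−1] → N → X → S X obtained by completing the morphism X → S X corresponding under the Serre duality isomorphism to a nonzero k-linear form on End(X) vanishing on rad End(X). -/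
open CategoryTheory CategoryTheory.Limits CategoryTheory.Pretriangulated

universe v u

namespace Paper

open CategoryTheory CategoryTheory.Limits CategoryTheory.Pretriangulated

variable {C : Type u} [Category.{v} C]

/-- A morphism `e : E ⟶ X` is right almost split if it is not a split epimorphism and every
morphism into `X` which is not a split epimorphism factors through it. -/
def IsRightAlmostSplit {E X : C} (e : E ⟶ X) : Prop :=
  ¬ IsSplitEpi e ∧ ∀ ⦃W : C⦄ (h : W ⟶ X), ¬ IsSplitEpi h → ∃ g : W ⟶ E, g ≫ e = h

/-- A morphism `d : Y ⟶ E` is left almost split if it is not a split monomorphism and every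
morphism out of `Y` which is not a split monomorphism factors through it. -/
def IsLeftAlmostSplit {Y E : C} (d : Y ⟶ E) : Prop :=
  ¬ IsSplitMono d ∧ ∀ ⦃W : C⦄ (h : Y ⟶ W), ¬ IsSplitMono h → ∃ g : E ⟶ W, d ≫ g = h

variable [HasShift C ℤ]

/-- A triangle `A → B → C → A⟦1⟧` is almost split if its first morphism is left almost split
and its second morphism is right almost split. -/
def IsAlmostSplitTriangle (T : Triangle C) : Prop :=
  IsLeftAlmostSplit T.mor₁ ∧ IsRightAlmostSplit T.mor₂

/-- The canonical isomorphism `(Y⟦-1⟧)⟦1⟧ ≅ Y`. -/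
noncomputable def unshiftShiftIso [HasShift C ℤ] (Y : C) : (Y⟦(-1 : ℤ)⟧)⟦(1 : ℤ)⟧ ≅ Y :=
  (shiftFunctorCompIsoId C (-1 : ℤ) (1 : ℤ) (by omega)).app Y

end Paper

namespace Paper

open CategoryTheory

variable {C : Type u} [Category.{v} C] [Preadditive C]

/-- `Hom(X, T)` is a module over `(End X)ᵐᵒᵖ` via precomposition. -/
instance homEndModule (X T : C) : Module (End X)ᵐᵒᵖ (X ⟶ T) where
  smul r φ := r.unop ≫ φ
  one_smul φ := Category.id_comp φ
  mul_smul r s φ := by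
    show ((r * s).unop) ≫ φ = r.unop ≫ (s.unop ≫ φ)
    rw [MulOpposite.unop_mul, End.mul_def, Category.assoc]
  smul_zero r := Limits.comp_zero
  smul_add r φ ψ := Preadditive.comp_add _ _ _ _ _ _
  add_smul r s φ := by
    show ((r + s).unop) ≫ φ = r.unop ≫ φ + s.unop ≫ φ
    rw [MulOpposite.unop_add, Preadditive.add_comp]
  zero_smul φ := by
    show ((0 : (End X)ᵐᵒᵖ).unop) ≫ φ = 0
    rw [MulOpposite.unop_zero]
    exact Limits.zero_comp

/-- Postcomposition with `f : T ⟶ T'` as an `(End X)ᵐᵒᵖ`-linear map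
`Hom(X, T) → Hom(X, T')`. -/
def postcompE (X : C) {T T' : C} (f : T ⟶ T') :
    (X ⟶ T) →ₗ[(End X)ᵐᵒᵖ] (X ⟶ T') where
  toFun φ := φ ≫ f
  map_add' φ ψ := Preadditive.add_comp _ _ _ _ _ _
  map_smul' r φ := by
    show (r.unop ≫ φ) ≫ f = r.unop ≫ (φ ≫ f)
    rw [Category.assoc]

end Paper

namespace Paper

section LocalRing

variable {R : Type*} [Ring R] [IsLocalRing R]

theorem isUnit_right_of_isUnit_mul {a b : R} (h : IsUnit (a * b)) : IsUnit b := by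
  obtain ⟨u, hu⟩ := h
  have hl : ((↑u⁻¹ : R) * a) * b = 1 := by rw [mul_assoc, ← hu, Units.inv_mul]
  generalize (↑u⁻¹ : R) * a = l at hl
  have hp : (b * l) * (b * l) = b * l := by
    rw [mul_assoc, ← mul_assoc l b l, hl, one_mul]
  rcases IsLocalRing.isUnit_or_isUnit_of_add_one (add_sub_cancel (b * l) 1) with h | h
  · have h1 : b * l = 1 := h.mul_left_cancel (by rw [hp, mul_one])
    exact ⟨⟨b, l, h1, hl⟩, rfl⟩
  · have h0 : b * l = 0 := h.mul_left_cancel (by rw [sub_mul, hp, one_mul, sub_self, mul_zero])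
    have : (1 : R) = 0 := by
      calc (1 : R) = (l * b) * (l * b) := by rw [hl, one_mul]
        _ = l * (b * l) * b := by simp only [mul_assoc]
        _ = 0 := by rw [h0, mul_zero, zero_mul]
    exact absurd this one_ne_zero

theorem mem_jacobson_bot_iff_not_isUnit {x : R} :
    x ∈ (⊥ : Ideal R).jacobson ↔ ¬ IsUnit x := by
  rw [Ideal.mem_jacobson_iff]
  constructor
  · rintro h ⟨u, rfl⟩
    obtain ⟨z, hz⟩ := h (-(↑u⁻¹ : R))
    simp [mul_assoc] at hz
  · intro hx y
    have hyx : ¬ IsUnit (-(y * x)) := fun h =>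
      hx (isUnit_right_of_isUnit_mul (IsUnit.neg_iff _ |>.1 h))
    obtain ⟨u, hu⟩ := (IsLocalRing.isUnit_or_isUnit_of_add_one
      (show -(y * x) + (1 + y * x) = 1 by abel)).resolve_left hyx
    refine ⟨(↑u⁻¹ : R), ?_⟩
    have h1 : (↑u⁻¹ : R) * (1 + y * x) = 1 := by rw [← hu, Units.inv_mul]
    rw [Ideal.mem_bot, sub_eq_zero, ← h1]
    noncomm_ring

end LocalRing

/-- Linear forms extend along injective linear maps over a `k`-algebra, where the action of `k`
is the one through the algebra. -/
theorem exists_extend_form {k : Type v} [CommRing k] {I : Type v} [AddCommGroup I] [Module k I]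
    [Module.Injective k I] {A : Type v} [Ring A] [Algebra k A]
    {M N : Type v} [AddCommGroup M] [Module A M] [AddCommGroup N] [Module A N]
    (f : M →ₗ[A] N) (hf : Function.Injective f) (φ : M →+ I)
    (hφ : ∀ (c : k) (m : M), φ (algebraMap k A c • m) = c • φ m) :
    ∃ ψ : N →+ I, (∀ (c : k) (n : N), ψ (algebraMap k A c • n) = c • ψ n) ∧
      ∀ m, ψ (f m) = φ m := by
  let _ : Module k M := Module.compHom M (algebraMap k A)
  let _ : Module k N := Module.compHom N (algebraMap k A)
  let f' : M →ₗ[k] N :=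
    { toFun := f
      map_add' := f.map_add
      map_smul' := fun c m => f.map_smul (algebraMap k A c) m }
  let φ' : M →ₗ[k] I :=
    { toFun := φ
      map_add' := φ.map_add
      map_smul' := hφ }
  obtain ⟨h, hh⟩ := Module.Injective.out f' hf φ'
  exact ⟨h.toAddMonoidHom, fun c n => h.map_smul c n, hh⟩

section Category

variable {C : Type u} [Category.{v} C]

theorem not_isUnit_comp_of_not_isSplitEpi {W X : C} {f : W ⟶ X} (hf : ¬ IsSplitEpi f)
    (g : X ⟶ W) : ¬ IsUnit (show End X from g ≫ f) := by
  rintro ⟨u, hu⟩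
  apply hf
  refine IsSplitEpi.mk' ⟨(↑u⁻¹ : End X) ≫ g, ?_⟩
  have : (u : End X) * (↑u⁻¹ : End X) = 1 := u.mul_inv
  rw [hu, End.mul_def] at this
  rw [Category.assoc]
  exact this

theorem isSplitMono_of_inv_comp {Y Y' Z : C} (u : Y ≅ Y') {f : Y ⟶ Z}
    (h : IsSplitMono (u.inv ≫ f)) : IsSplitMono f := by
  obtain ⟨⟨r, hr⟩⟩ := h
  refine IsSplitMono.mk' ⟨r ≫ u.inv, ?_⟩
  rw [← cancel_epi u.inv, ← Category.assoc, ← Category.assoc, hr, Category.id_comp,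
    Category.comp_id]

theorem isSplitMono_of_isSplitMono_shift [HasShift C ℤ] {Y Z : C} {f : Y ⟶ Z}
    (h : IsSplitMono (f⟦(1 : ℤ)⟧')) : IsSplitMono f := by
  obtain ⟨⟨r, hr⟩⟩ := h
  refine IsSplitMono.mk' ⟨(shiftFunctor C (1 : ℤ)).preimage r, ?_⟩
  apply (shiftFunctor C (1 : ℤ)).map_injective
  simpa using hr

end Category

variable {C : Type u} [Category.{v} C] [Preadditive C]

/-- An endomorphism as an element of the opposite of the endomorphism ring. -/
abbrev toEndOp {X : C} (f : X ⟶ X) : (End X)ᵐᵒᵖ := MulOpposite.op f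

variable {k : Type v} [CommRing k] {I : Type v} [AddCommGroup I] [Module k I]
  [CategoryTheory.Linear k C]

/-- The dual of `End X` is a module over `(End X)ᵐᵒᵖ`. -/
instance endDualModule (X : C) : Module (End X)ᵐᵒᵖ ((X ⟶ X) →ₗ[k] I) where
  smul r φ := φ.comp (Linear.rightComp k X (r.unop : X ⟶ X))
  one_smul φ := by
    ext f
    exact congrArg φ (Category.comp_id f)
  mul_smul r s φ := by
    ext f
    exact congrArg φ (Category.assoc f r.unop s.unop).symm
  smul_zero r := rfl
  smul_add r φ ψ := rfl
  add_smul r s φ := by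
    ext f
    exact (congrArg φ (Preadditive.comp_add _ _ _ f r.unop s.unop)).trans (φ.map_add _ _)
  zero_smul φ := by
    ext f
    exact (congrArg φ (Limits.comp_zero (f := f) (Z := X))).trans φ.map_zero

theorem endDualModule_smul_apply {X : C} (r : (End X)ᵐᵒᵖ) (φ : (X ⟶ X) →ₗ[k] I) (f : X ⟶ X) :
    (r • φ) f = φ (f ≫ r.unop) := rfl

section Envelope

variable {X : C} [IsLocalRing (End X)] {IX : Type v} [AddCommGroup IX] [Module (End X)ᵐᵒᵖ IX]

/-- An injective envelope of the simple `End X`-module is a direct summand of the dual of `End X`,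
in such a way that a given nonzero form vanishing on the radical spans the socle. -/
theorem exists_retract_endDual [Module.Injective k I]
    (hIinj : Module.Injective (End X)ᵐᵒᵖ IX)
    (e : ((End X)ᵐᵒᵖ ⧸ (⊥ : Ideal (End X)ᵐᵒᵖ).jacobson) →ₗ[(End X)ᵐᵒᵖ] IX)
    (he : Function.Injective e)
    (hess : ∀ N : Submodule (End X)ᵐᵒᵖ IX, N ⊓ LinearMap.range e = ⊥ → N = ⊥)
    (γ : (X ⟶ X) →ₗ[k] I) (hγ : γ ≠ 0)
    (hrad : ∀ r : End X, ¬ IsUnit r → γ (r : X ⟶ X) = 0) :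
    ∃ (x₀ : IX) (i : IX →ₗ[(End X)ᵐᵒᵖ] ((X ⟶ X) →ₗ[k] I))
      (p : ((X ⟶ X) →ₗ[k] I) →ₗ[(End X)ᵐᵒᵖ] IX),
      (∀ y, p (i y) = y) ∧ i x₀ = γ ∧ ∀ y, y ≠ 0 → ∃ r : (End X)ᵐᵒᵖ, r • y = x₀ := by
  have : IsLocalRing (End X)ᵐᵒᵖ := ⟨fun {a b} h => by
    have h' : a.unop + b.unop = 1 := congrArg MulOpposite.unop h
    exact (IsLocalRing.isUnit_or_isUnit_of_add_one h').imp
      isUnit_unop.1 isUnit_unop.1⟩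
  let J := (⊥ : Ideal (End X)ᵐᵒᵖ).jacobson
  have hJγ : ∀ r ∈ J, γ (r.unop : X ⟶ X) = 0 := fun r hr =>
    hrad _ fun hu => mem_jacobson_bot_iff_not_isUnit.1 hr (isUnit_unop.1 hu)
  let γ₀ : (End X)ᵐᵒᵖ →+ I :=
    { toFun := fun r => γ (r.unop : X ⟶ X)
      map_zero' := γ.map_zero
      map_add' := fun r s => γ.map_add (r.unop : X ⟶ X) (s.unop : X ⟶ X) }
  let φ : ((End X)ᵐᵒᵖ ⧸ J) →+ I := QuotientAddGroup.lift J.toAddSubgroup γ₀ hJγ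
  have hφ : ∀ r : (End X)ᵐᵒᵖ, φ (Submodule.Quotient.mk r) = γ (r.unop : X ⟶ X) := fun r => rfl
  obtain ⟨ψ, hψk, hψ⟩ := exists_extend_form (k := k) e he φ (by
    intro c m
    obtain ⟨r, rfl⟩ := Submodule.Quotient.mk_surjective _ m
    rw [← Submodule.Quotient.mk_smul, hφ, hφ, ← γ.map_smul]
    refine congrArg γ ?_
    have : algebraMap k (End X)ᵐᵒᵖ c • r = c • r := algebraMap_smul _ _ _
    rw [this]
    rfl)
  let i : IX →ₗ[(End X)ᵐᵒᵖ] ((X ⟶ X) →ₗ[k] I) :=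
    { toFun := fun y =>
        { toFun := fun f => ψ (toEndOp f • y)
          map_add' := fun f g => by
            rw [← map_add, ← add_smul]
            rfl
          map_smul' := fun c f => by
            rw [RingHom.id_apply, ← hψk, ← mul_smul, ← Algebra.smul_def]
            rfl }
      map_add' := fun y z => by
        ext f
        exact (congrArg ψ (smul_add _ y z)).trans (ψ.map_add _ _)
      map_smul' := fun r y => by
        ext f
        change ψ (toEndOp f • r • y) = ψ (toEndOp (f ≫ r.unop) • y)
        rw [← mul_smul]
        rfl }
  have hi : ∀ y f, i y f = ψ (toEndOp f • y) := fun y f => rfl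
  let x₀ : IX := e (Submodule.Quotient.mk 1)
  have hx₀ : ∀ r : (End X)ᵐᵒᵖ, e (Submodule.Quotient.mk r) = r • x₀ := fun r => by
    rw [← e.map_smul, ← Submodule.Quotient.mk_smul, smul_eq_mul, mul_one]
  have hix₀ : i x₀ = γ := by
    ext f
    rw [hi, ← hx₀, hψ, hφ]
    rfl
  have hsoc : ∀ y, y ≠ 0 → ∃ r : (End X)ᵐᵒᵖ, r • y = x₀ := by
    intro y hy
    have hne : Submodule.span (End X)ᵐᵒᵖ {y} ⊓ LinearMap.range e ≠ ⊥ := fun h =>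
      hy (Submodule.span_singleton_eq_bot.1 (hess _ h))
    obtain ⟨z, ⟨hz, m, rfl⟩, hz0⟩ := Submodule.exists_mem_ne_zero_of_ne_bot hne
    obtain ⟨r, hr⟩ := Submodule.mem_span_singleton.1 hz
    obtain ⟨s, rfl⟩ := Submodule.Quotient.mk_surjective _ m
    have hs : IsUnit s := by
      by_contra hs
      apply hz0
      rw [(Submodule.Quotient.mk_eq_zero _).2 (mem_jacobson_bot_iff_not_isUnit.2 hs), map_zero]
    obtain ⟨u, rfl⟩ := hs
    refine ⟨(↑u⁻¹ : (End X)ᵐᵒᵖ) * r, ?_⟩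
    rw [mul_smul, hr, hx₀, ← mul_smul, Units.inv_mul, one_smul]
  have hinj : Function.Injective i := by
    rw [injective_iff_map_eq_zero]
    intro y hy
    by_contra hy0
    obtain ⟨r, hr⟩ := hsoc y hy0
    apply hγ
    rw [← hix₀, ← hr, map_smul, hy, smul_zero]
  obtain ⟨p, hp⟩ := hIinj.out i hinj LinearMap.id
  exact ⟨x₀, i, p, hp, hix₀, hsoc⟩

end Envelope

section Representability

variable {X SX : C} {IX : Type v} [AddCommGroup IX] [Module (End X)ᵐᵒᵖ IX]

/-- A `k`-linear form on `Hom(X, T)`, seen as an `(End X)ᵐᵒᵖ`-linear map to the dual of `End X`. -/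
def coinduceForm {T : C} (φ : (X ⟶ T) →ₗ[k] I) :
    (X ⟶ T) →ₗ[(End X)ᵐᵒᵖ] ((X ⟶ X) →ₗ[k] I) where
  toFun f := φ.comp (Linear.rightComp k X f)
  map_add' f g := by
    ext x
    exact (congrArg φ (Preadditive.comp_add _ _ _ x f g)).trans (φ.map_add _ _)
  map_smul' r f := by
    ext x
    exact congrArg φ (Category.assoc x r.unop f).symm

/-- An `(End X)ᵐᵒᵖ`-linear map from `Hom(X, T)` to the dual of `End X`, evaluated at the
identity. -/
def evalOneForm {T : C} (ψ : (X ⟶ T) →ₗ[(End X)ᵐᵒᵖ] ((X ⟶ X) →ₗ[k] I)) :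
    (X ⟶ T) →ₗ[k] I where
  toFun f := ψ f (𝟙 X)
  map_add' f g := by rw [map_add, LinearMap.add_apply]
  map_smul' c f := by
    have h : c • f = toEndOp (c • 𝟙 X) • f := by
      change c • f = (c • 𝟙 X) ≫ f
      rw [Linear.smul_comp, Category.id_comp]
    rw [h, map_smul, endDualModule_smul_apply]
    change ψ f (𝟙 X ≫ (c • 𝟙 X)) = c • ψ f (𝟙 X)
    rw [Category.id_comp, map_smul]

theorem coinduceForm_evalOneForm {T : C} (ψ : (X ⟶ T) →ₗ[(End X)ᵐᵒᵖ] ((X ⟶ X) →ₗ[k] I)) :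
    coinduceForm (evalOneForm ψ) = ψ := by
  ext f x
  change ψ (toEndOp x • f) (𝟙 X) = ψ f x
  rw [map_smul, endDualModule_smul_apply]
  exact congrArg (ψ f) (Category.id_comp x)

/-- If `IX` is a direct summand of the dual of `End X`, then `Hom_{End X}(Hom(X, -), IX)` is
represented by a direct summand of the Serre dual of `X`. -/
theorem exists_representation_of_retract [IsIdempotentComplete C] (D : SerreDualityData k I X SX)
    (i : IX →ₗ[(End X)ᵐᵒᵖ] ((X ⟶ X) →ₗ[k] I))
    (p : ((X ⟶ X) →ₗ[k] I) →ₗ[(End X)ᵐᵒᵖ] IX) (hp : ∀ y, p (i y) = y) :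
    ∃ (Y : C) (s : Y ⟶ SX) (q : SX ⟶ Y)
      (σ : ∀ T : C, ((X ⟶ T) →ₗ[(End X)ᵐᵒᵖ] IX) ≃+ (T ⟶ Y)),
      s ≫ q = 𝟙 Y ∧
      (∀ (T T' : C) (f : T ⟶ T') (φ : (X ⟶ T') →ₗ[(End X)ᵐᵒᵖ] IX),
        σ T (φ.comp (postcompE X f)) = f ≫ σ T' φ) ∧
      ∀ (T : C) (φ : (X ⟶ T) →ₗ[(End X)ᵐᵒᵖ] IX),
        σ T φ ≫ s = D.equiv T (evalOneForm (i.comp φ)) := by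
  let A : ∀ T : C, ((X ⟶ T) →ₗ[(End X)ᵐᵒᵖ] IX) → (T ⟶ SX) :=
    fun T φ => D.equiv T (evalOneForm (i.comp φ))
  let B : ∀ T : C, (T ⟶ SX) → ((X ⟶ T) →ₗ[(End X)ᵐᵒᵖ] IX) :=
    fun T g => p.comp (coinduceForm ((D.equiv T).symm g))
  have hBA : ∀ T φ, B T (A T φ) = φ := fun T φ => by
    simp only [A, B, LinearEquiv.symm_apply_apply, coinduceForm_evalOneForm]
    ext f
    exact hp _
  have hA : ∀ {T T' : C} (f : T ⟶ T') (φ : (X ⟶ T') →ₗ[(End X)ᵐᵒᵖ] IX),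
      A T (φ.comp (postcompE X f)) = f ≫ A T' φ := fun {_ _} f φ =>
    D.naturality f (evalOneForm (i.comp φ))
  have hB : ∀ {T T' : C} (f : T ⟶ T') (g : T' ⟶ SX),
      B T (f ≫ g) = (B T' g).comp (postcompE X f) := fun {T T'} f g => by
    have h : (D.equiv T).symm (f ≫ g) =
        ((D.equiv T').symm g).comp (Linear.rightComp k X f) := by
      rw [LinearEquiv.symm_apply_eq, D.naturality, LinearEquiv.apply_symm_apply]
    ext x
    change p (coinduceForm ((D.equiv T).symm (f ≫ g)) x) =
      p (coinduceForm ((D.equiv T').symm g) (x ≫ f))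
    rw [h]
    congr 1
    ext y
    exact congrArg ((D.equiv T').symm g) (Category.assoc y x f)
  have hAadd : ∀ T φ ψ, A T (φ + ψ) = A T φ + A T ψ := fun T φ ψ => by
    rw [← map_add]
    refine congrArg (D.equiv T) ?_
    ext f
    change i (φ f + ψ f) (𝟙 X) = i (φ f) (𝟙 X) + i (ψ f) (𝟙 X)
    rw [map_add, LinearMap.add_apply]
  let ε : SX ⟶ SX := A SX (B SX (𝟙 SX))
  have hε : ∀ {T : C} (g : T ⟶ SX), g ≫ ε = A T (B T g) := fun {T} g => by
    rw [← hA, ← hB, Category.comp_id]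
  obtain ⟨Y, s, q, hsq, hqs⟩ := IsIdempotentComplete.idempotents_split SX ε (by
    rw [hε, hBA])
  have hsε : s ≫ ε = s := by rw [← hqs, reassoc_of% hsq]
  have hAε : ∀ T φ, A T φ ≫ q ≫ s = A T φ := fun T φ => by rw [hqs, hε, hBA]
  refine ⟨Y, s, q, fun T =>
    { toFun := fun φ => A T φ ≫ q
      invFun := fun g => B T (g ≫ s)
      left_inv := fun φ => by
        change B T ((A T φ ≫ q) ≫ s) = φ
        rw [Category.assoc, hAε, hBA]
      right_inv := fun g => by
        change A T (B T (g ≫ s)) ≫ q = g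
        rw [← hε, Category.assoc g s ε, hsε, Category.assoc, hsq, Category.comp_id]
      map_add' := fun φ ψ => by
        change A T (φ + ψ) ≫ q = A T φ ≫ q + A T ψ ≫ q
        rw [hAadd, Preadditive.add_comp] }, hsq, ?_, ?_⟩
  · intro T T' f φ
    change A T _ ≫ q = f ≫ A T' φ ≫ q
    rw [hA, Category.assoc]
  · intro T φ
    change (A T φ ≫ q) ≫ s = A T φ
    rw [Category.assoc, hAε]

end Representability

theorem exists_form_ne_zero (hcog : IsCogenerator k I) (X : C) [IsLocalRing (End X)] :
    ∃ γ : (X ⟶ X) →ₗ[k] I, γ ≠ 0 ∧ ∀ r : End X, ¬ IsUnit r → γ (r : X ⟶ X) = 0 := by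
  let J : Submodule k (End X) := (⊥ : Ideal (End X)).jacobson.restrictScalars k
  have h1 : (Submodule.Quotient.mk 1 : End X ⧸ J) ≠ 0 := by
    rw [Ne, Submodule.Quotient.mk_eq_zero]
    exact fun h => mem_jacobson_bot_iff_not_isUnit.1 h isUnit_one
  obtain ⟨φ, hφ⟩ := hcog (End X ⧸ J) _ h1
  refine ⟨φ.comp J.mkQ, fun h => hφ ?_, fun r hr => ?_⟩
  · exact LinearMap.congr_fun h (𝟙 X)
  · have : (Submodule.Quotient.mk r : End X ⧸ J) = 0 :=
      (Submodule.Quotient.mk_eq_zero _).2 (mem_jacobson_bot_iff_not_isUnit.2 hr)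
    exact (congrArg φ this).trans φ.map_zero

variable [HasZeroObject C] [HasShift C ℤ] [∀ n : ℤ, (shiftFunctor C n).Additive]
  [Pretriangulated C]

theorem isSplitMono_of_mor₁_eq_zero {T : Triangle C} (hT : T ∈ distTriang C)
    (h : T.mor₁ = 0) : IsSplitMono T.mor₂ := by
  obtain ⟨r, hr⟩ := T.yoneda_exact₂ hT (𝟙 _) (by rw [h, zero_comp])
  exact IsSplitMono.mk' ⟨r, hr.symm⟩

/-- A distinguished triangle with nonzero third morphism `c` is almost split if `c` is killed by
precomposition with non-split epimorphisms, and by postcomposition with non-split monomorphisms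
(in shifted degree). -/
theorem isAlmostSplitTriangle_of_mor₃ {T : Triangle C} (hT : T ∈ distTriang C) (hc : T.mor₃ ≠ 0)
    (hepi : ∀ ⦃W : C⦄ (f : W ⟶ T.obj₃), ¬ IsSplitEpi f → f ≫ T.mor₃ = 0)
    (hmono : ∀ ⦃Z : C⦄ (f : T.obj₁⟦(1 : ℤ)⟧ ⟶ Z), ¬ IsSplitMono f → T.mor₃ ≫ f = 0) :
    IsAlmostSplitTriangle T := by
  refine ⟨⟨fun h => hc (T.mor₃_eq_zero_of_mono₁ hT inferInstance), fun W f hf => ?_⟩,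
    ⟨fun h => hc (T.mor₃_eq_zero_of_epi₂ hT inferInstance), fun W f hf => ?_⟩⟩
  · have h0 := hmono (f⟦(1 : ℤ)⟧') fun h => hf (isSplitMono_of_isSplitMono_shift h)
    obtain ⟨g, hg⟩ : ∃ g : T.obj₂⟦(1 : ℤ)⟧ ⟶ W⟦(1 : ℤ)⟧,
        f⟦(1 : ℤ)⟧' = (-T.mor₁⟦(1 : ℤ)⟧') ≫ g :=
      Triangle.yoneda_exact₂ _ (rot_of_distTriang _ (rot_of_distTriang _ hT)) (f⟦(1 : ℤ)⟧') h0
    refine ⟨-(shiftFunctor C (1 : ℤ)).preimage g, ?_⟩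
    apply (shiftFunctor C (1 : ℤ)).map_injective
    rw [hg]
    simp
  · obtain ⟨g, hg⟩ := T.coyoneda_exact₃ hT f (hepi f hf)
    exact ⟨g, hg.symm⟩

/-- A distinguished triangle is a direct summand of another one with the same third object as soon
as its first object is a direct summand of the first object of the other, compatibly with the
third morphisms. -/
theorem exists_triangle_retract {T T' : Triangle C} (hT : T ∈ distTriang C)
    (hT' : T' ∈ distTriang C) (s : T.obj₁ ⟶ T'.obj₁) (q : T'.obj₁ ⟶ T.obj₁) (hsq : s ≫ q = 𝟙 _)
    (α : T.obj₃ ≅ T'.obj₃) (hs : T.mor₃ ≫ s⟦(1 : ℤ)⟧' = α.hom ≫ T'.mor₃) :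
    ∃ (ι : T ⟶ T') (π : T' ⟶ T), ι ≫ π = 𝟙 T := by
  have hq : T'.mor₃ ≫ q⟦(1 : ℤ)⟧' = α.inv ≫ T.mor₃ := by
    rw [← cancel_epi α.hom, ← Category.assoc, ← hs, Category.assoc, ← Functor.map_comp, hsq,
      CategoryTheory.Functor.map_id, Category.comp_id, α.hom_inv_id_assoc]
  obtain ⟨b, hb₁, hb₂⟩ := complete_distinguished_triangle_morphism₂ T T' hT hT' s α.hom hs
  obtain ⟨b', hb'₁, hb'₂⟩ := complete_distinguished_triangle_morphism₂ T' T hT' hT q α.inv hq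
  let ι : T ⟶ T' := { hom₁ := s, hom₂ := b, hom₃ := α.hom, comm₁ := hb₁, comm₂ := hb₂, comm₃ := hs }
  let π : T' ⟶ T :=
    { hom₁ := q, hom₂ := b', hom₃ := α.inv, comm₁ := hb'₁, comm₂ := hb'₂, comm₃ := hq }
  have h₁ : (ι ≫ π).hom₁ = 𝟙 _ := hsq
  have h₃ : (ι ≫ π).hom₃ = 𝟙 _ := α.hom_inv_id
  have i₁ : IsIso (ι ≫ π).hom₁ := by rw [h₁]; infer_instance
  have i₃ : IsIso (ι ≫ π).hom₃ := by rw [h₃]; infer_instance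
  have i₂ : IsIso (ι ≫ π).hom₂ := isIso₂_of_isIso₁₃ _ hT hT i₁ i₃
  have : IsIso (ι ≫ π) := Triangle.isIso_of_isIsos _ i₁ i₂ i₃
  exact ⟨ι, π ≫ inv (ι ≫ π), by rw [← Category.assoc, IsIso.hom_inv_id]⟩

end Paper

open Paper in
/-- Let `T` be an idempotent complete triangulated `k`-category and
`S : X → T` a partial Serre functor.  Let `X ∈ X` have local endomorphism ring, and let
`I_X` be an injective envelope of the simple `End(X)`-module.  Then (1) the functor
`Hom_{End X}(Hom(X,-), I_X)` is representable, so there is an almost split triangle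
`τX → M → X → τX⟦1⟧`, and (2) this almost split triangle is a direct summand of the
triangle `S X⟦-1⟧ → N → X → S X` obtained by completing the morphism `X → S X`
corresponding to a nonzero `k`-linear form on `End X` vanishing on `rad End X`. -/
theorem serre_representability_and_almost_split_summand
    (k : Type v) [CommRing k] (I : Type v) [AddCommGroup I] [Module k I]
    [Module.Injective k I] (hcog : IsCogenerator k I)
    {C : Type u} [Category.{v} C] [Preadditive C]
    [CategoryTheory.Linear k C] [HasZeroObject C] [HasShift C ℤ]
    [∀ n : ℤ, (shiftFunctor C n).Additive] [Pretriangulated C] [IsIdempotentComplete C]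
    (X SX : C) (D : SerreDualityData k I X SX) [IsLocalRing (End X)]
    (IX : Type v) [AddCommGroup IX] [Module (End X)ᵐᵒᵖ IX]
    (hIinj : Module.Injective (End X)ᵐᵒᵖ IX)
    (hIenv : ∃ e : ((End X)ᵐᵒᵖ ⧸ (⊥ : Ideal (End X)ᵐᵒᵖ).jacobson) →ₗ[(End X)ᵐᵒᵖ] IX,
      Function.Injective e ∧
        ∀ N : Submodule (End X)ᵐᵒᵖ IX, N ⊓ LinearMap.range e = ⊥ → N = ⊥) :
    -- (1) the functor `Hom_{End X}(Hom(X,-), I_X)` is representable …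
    (∃ (τX1 : C) (σ : ∀ T : C, ((X ⟶ T) →ₗ[(End X)ᵐᵒᵖ] IX) ≃+ (T ⟶ τX1)),
      ∀ (T T' : C) (f : T ⟶ T') (φ : (X ⟶ T') →ₗ[(End X)ᵐᵒᵖ] IX),
        σ T (φ.comp (postcompE X f)) = f ≫ σ T' φ) ∧
    -- … so the almost split triangle ending at `X` exists, and (2) for every triangle
    -- `S X⟦-1⟧ → N → X → S X` built from a nonzero form on `End X` killing the radical,
    -- the almost split triangle is one of its direct summands.
    (∀ (γ : (X ⟶ X) →ₗ[k] I), γ ≠ 0 →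
      (∀ r : End X, r ∈ (⊥ : Ideal (End X)).jacobson → γ (r : X ⟶ X) = 0) →
      ∀ (N : C) (d : SX⟦(-1 : ℤ)⟧ ⟶ N) (n : N ⟶ X),
        (Triangle.mk d n (D.equiv X γ ≫ (unshiftShiftIso SX).inv) ∈ distTriang C) →
        ∃ (τX M : C) (a : τX ⟶ M) (b : M ⟶ X) (c : X ⟶ τX⟦(1 : ℤ)⟧),
          (Triangle.mk a b c ∈ distTriang C) ∧
          IsAlmostSplitTriangle (Triangle.mk a b c) ∧
          ∃ (ι : Triangle.mk a b c ⟶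
                Triangle.mk d n (D.equiv X γ ≫ (unshiftShiftIso SX).inv))
            (π : Triangle.mk d n (D.equiv X γ ≫ (unshiftShiftIso SX).inv) ⟶
                Triangle.mk a b c),
            ι ≫ π = 𝟙 (Triangle.mk a b c)) := by
  obtain ⟨e, he, hess⟩ := hIenv
  constructor
  · obtain ⟨γ, hγ, hrad⟩ := exists_form_ne_zero (k := k) hcog X
    obtain ⟨x₀, i, p, hp, -, -⟩ := exists_retract_endDual hIinj e he hess γ hγ hrad
    obtain ⟨Y, s, q, σ, -, hσ, -⟩ := exists_representation_of_retract D i p hp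
    exact ⟨Y, σ, hσ⟩
  · intro γ hγ hrad N d n hdist
    have hrad' : ∀ r : End X, ¬ IsUnit r → γ (r : X ⟶ X) = 0 := fun r hr =>
      hrad r (mem_jacobson_bot_iff_not_isUnit.2 hr)
    obtain ⟨x₀, i, p, hp, hx₀, hsoc⟩ := exists_retract_endDual hIinj e he hess γ hγ hrad'
    obtain ⟨Y, s, q, σ, hsq, hσ, hσs⟩ := exists_representation_of_retract D i p hp
    let ψ₀ : (X ⟶ X) →ₗ[(End X)ᵐᵒᵖ] IX :=
      { toFun := fun f => toEndOp f • x₀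
        map_add' := fun f g => add_smul (toEndOp f) (toEndOp g) x₀
        map_smul' := fun r f => mul_smul r (toEndOp f) x₀ }
    obtain ⟨c₀, hc₀⟩ : ∃ c₀ : X ⟶ Y, c₀ = σ X ψ₀ := ⟨_, rfl⟩
    have hc₀s : c₀ ≫ s = D.equiv X γ := by
      rw [hc₀, hσs]
      congr 1
      ext f
      change i (toEndOp f • x₀) (𝟙 X) = γ f
      rw [map_smul, hx₀, endDualModule_smul_apply]
      exact congrArg γ (Category.id_comp f)
    have hc₀0 : c₀ ≠ 0 := by
      rintro rfl
      rw [zero_comp] at hc₀s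
      exact hγ ((D.equiv X).map_eq_zero_iff.1 hc₀s.symm)
    have hepi : ∀ ⦃W : C⦄ (f : W ⟶ X), ¬ IsSplitEpi f → f ≫ c₀ = 0 := by
      intro W f hf
      have h : f ≫ D.equiv X γ = 0 := by
        rw [← D.naturality, LinearEquiv.map_eq_zero_iff]
        ext g
        exact hrad' _ (not_isUnit_comp_of_not_isSplitEpi hf g)
      calc f ≫ c₀ = (f ≫ c₀ ≫ s) ≫ q := by
            rw [Category.assoc, Category.assoc, hsq, Category.comp_id]
        _ = 0 := by rw [hc₀s, h, zero_comp]
    have hmono : ∀ ⦃Z : C⦄ (f : Y ⟶ Z), ¬ IsSplitMono f → c₀ ≫ f = 0 := by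
      intro Z f hf
      obtain ⟨K, t, w, hK⟩ := distinguished_cocone_triangle₁ f
      have ht : t ≠ 0 := fun ht => hf (isSplitMono_of_mor₁_eq_zero hK ht)
      obtain ⟨φ, rfl⟩ := (σ K).surjective t
      have hφ : φ ≠ 0 := fun h => ht (by rw [h, map_zero])
      obtain ⟨x, hx⟩ : ∃ x, φ x ≠ 0 := by
        by_contra! h
        exact hφ (LinearMap.ext h)
      obtain ⟨r, hr⟩ := hsoc _ hx
      have hfac : (r • x) ≫ σ K φ = c₀ := by
        rw [← hσ, hc₀]
        congr 1
        refine LinearMap.ext fun g => ?_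
        change φ (toEndOp g • r • x) = toEndOp g • x₀
        rw [map_smul, map_smul, hr]
      rw [← hfac, Category.assoc]
      exact (congrArg _ (comp_distTriang_mor_zero₁₂ _ hK)).trans comp_zero
    let u := unshiftShiftIso Y
    obtain ⟨M, a, b, hab⟩ := distinguished_cocone_triangle₂ (c₀ ≫ u.inv)
    refine ⟨Y⟦(-1 : ℤ)⟧, M, a, b, c₀ ≫ u.inv, hab,
      isAlmostSplitTriangle_of_mor₃ hab ?_ ?_ ?_, ?_⟩
    · intro h
      exact hc₀0 ((cancel_mono u.inv).1 (h.trans zero_comp.symm))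
    · intro W f hf
      exact (Category.assoc f c₀ u.inv).symm.trans
        ((congrArg (· ≫ u.inv) (hepi f hf)).trans zero_comp)
    · intro Z f hf
      exact (Category.assoc c₀ u.inv f).trans
        (hmono (u.inv ≫ f) fun h => hf (isSplitMono_of_inv_comp u h))
    · refine exists_triangle_retract hab hdist (s⟦(-1 : ℤ)⟧') (q⟦(-1 : ℤ)⟧') ?_ (Iso.refl X) ?_
      · change s⟦(-1 : ℤ)⟧' ≫ q⟦(-1 : ℤ)⟧' = 𝟙 _
        rw [← Functor.map_comp, hsq, CategoryTheory.Functor.map_id]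
      · change (c₀ ≫ u.inv) ≫ s⟦(-1 : ℤ)⟧'⟦(1 : ℤ)⟧' =
          𝟙 X ≫ D.equiv X γ ≫ (unshiftShiftIso SX).inv
        have hu : u.inv ≫ s⟦(-1 : ℤ)⟧'⟦(1 : ℤ)⟧' = s ≫ (unshiftShiftIso SX).inv :=
          ((shiftFunctorCompIsoId C (-1 : ℤ) (1 : ℤ) (by omega)).inv.naturality s).symm
        rw [Category.assoc, hu, Category.id_comp, ← hc₀s, Category.assoc]
end

section
/- Assume k is a commutative noetherian ring and let I = ⊕_{m ∈ MaxSpec k} E(k/m) be the direct sum of the injective envelopes of the simple k-modules. Let S : X → T be a partial Serre functor (with respect to this I). If X ∈ X has local endomorphism ring which is finitely generated as a k-module, then the triangle S X[−1] → N → X → S X, obtained by completing the morphism X → S X corresponding under the Serre duality isomorphism to a nonzero k-linear form on End(X) vanishing on rad End(X), is an almost split triangle. -/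
open CategoryTheory CategoryTheory.Limits CategoryTheory.Pretriangulated

universe v u

section Matlis

variable {k : Type v} [CommRing k]

/-- Over a noetherian ring, a direct sum of injective modules is injective. -/
theorem injective_directSum [IsNoetherianRing k] {ι : Type v} (E : ι → Type v)
    [∀ i, AddCommGroup (E i)] [∀ i, Module k (E i)] (hE : ∀ i, Module.Injective k (E i)) :
    Module.Injective k (DirectSum ι E) := by
  classical
  refine Module.Baer.injective fun J g => ?_
  obtain ⟨S, hS⟩ : (⊤ : Submodule k J).FG := IsNoetherian.noetherian _
  have ext (i : ι) := Module.Baer.of_injective (hE i) J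
    ((DirectSum.component k ι E i).comp g)
  choose l hl using ext
  let s : Finset ι := S.biUnion fun x => DFinsupp.support (g x)
  have hs (x : J) : (g x) = ∑ i ∈ s, DirectSum.lof k ι E i (g x i) := by
    have hx : x ∈ Submodule.span k (S : Set J) := hS ▸ Submodule.mem_top
    induction hx using Submodule.span_induction with
    | mem x hx =>
      conv_lhs => rw [← DirectSum.sum_support_of (g x)]
      refine Finset.sum_subset (Finset.subset_biUnion_of_mem (fun x => DFinsupp.support (g x)) hx)
        fun i _ hi => ?_
      rw [DFinsupp.notMem_support_iff.mp hi, map_zero]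
    | zero => simp
    | add x y _ _ hx hy =>
      rw [map_add]
      simp only [DirectSum.add_apply, map_add, Finset.sum_add_distrib]
      rw [← hx, ← hy]
    | smul a x _ hx =>
      rw [map_smul]
      simp only [DirectSum.smul_apply, map_smul]
      rw [← Finset.smul_sum, ← hx]
  refine ⟨∑ i ∈ s, (DirectSum.lof k ι E i).comp (l i), fun x hx => ?_⟩
  rw [hs ⟨x, hx⟩]
  rw [LinearMap.sum_apply]
  refine Finset.sum_congr rfl fun i _ => ?_
  rw [LinearMap.comp_apply, hl i x hx]
  rfl

/-- The dual of a finite length module is at most as long as the module, provided this holds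
for simple modules. -/
theorem length_hom_le {I : Type v} [AddCommGroup I] [Module k I]
    (hI : ∀ (S : Type v) [AddCommGroup S] [Module k S] [IsSimpleModule k S],
      Module.length k (S →ₗ[k] I) ≤ 1)
    {M : Type v} [AddCommGroup M] [Module k M] (hM : IsFiniteLength k M) :
    Module.length k (M →ₗ[k] I) ≤ Module.length k M := by
  induction hM with
  | of_subsingleton => simp
  | @of_simple_quotient M _ _ P _ _ ih =>
    let r : (M →ₗ[k] I) →ₗ[k] (P →ₗ[k] I) := LinearMap.lcomp k I P.subtype
    have hker : Module.length k (LinearMap.ker r) ≤ Module.length k ((M ⧸ P) →ₗ[k] I) := by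
      let q : ((M ⧸ P) →ₗ[k] I) →ₗ[k] (M →ₗ[k] I) := LinearMap.lcomp k I P.mkQ
      have hle : LinearMap.ker r ≤ LinearMap.range q := fun φ hφ =>
        ⟨P.liftQ φ fun x hx => LinearMap.congr_fun (LinearMap.mem_ker.mp hφ) ⟨x, hx⟩,
          LinearMap.ext fun _ => rfl⟩
      exact (Module.length_le_of_injective _ (Submodule.inclusion_injective hle)).trans
        (Module.length_le_of_surjective q.rangeRestrict q.surjective_rangeRestrict)
    rw [Module.length_eq_add_of_exact (LinearMap.ker r).subtype r.rangeRestrict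
        (Submodule.subtype_injective _) r.surjective_rangeRestrict
        (by rw [LinearMap.exact_iff, LinearMap.ker_rangeRestrict, Submodule.range_subtype]),
      Module.length_eq_add_of_exact P.subtype P.mkQ (Submodule.subtype_injective _)
        P.mkQ_surjective (LinearMap.exact_subtype_mkQ P), add_comm]
    refine add_le_add ((Module.length_le_of_injective _ (Submodule.subtype_injective _)).trans ih) ?_
    rw [Module.length_eq_one k (M ⧸ P)]
    exact hker.trans (hI (M ⧸ P))

/-- An injective linear map into a module of finite, not larger, length is surjective. -/
theorem surjective_of_injective_of_length_le {M N : Type*} [AddCommGroup M] [Module k M]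
    [AddCommGroup N] [Module k N] (f : M →ₗ[k] N) (hf : Function.Injective f)
    (hM : Module.length k M ≠ ⊤) (h : Module.length k N ≤ Module.length k M) :
    Function.Surjective f := by
  rw [Module.length_eq_add_of_exact f (LinearMap.range f).mkQ hf
    (Submodule.mkQ_surjective _) (LinearMap.exact_map_mkQ_range f)] at h
  have h0 : Module.length k (N ⧸ LinearMap.range f) = 0 := by
    refine le_antisymm ((ENat.add_le_add_iff_left hM).mp (h.trans ?_)) zero_le
    simp
  rw [Module.length_eq_zero_iff, Submodule.Quotient.subsingleton_iff] at h0
  exact LinearMap.range_eq_top.mp h0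

/-- If all cyclic submodules of `I` are artinian, so is the quotient of `M` by the left kernel of
a bilinear form `M × N → I` with `N` finitely generated. -/
theorem isFiniteLength_quotient_ker [IsNoetherianRing k] {I : Type v} [AddCommGroup I] [Module k I]
    (hI : ∀ y : I, IsArtinian k (Submodule.span k {y}))
    {M N : Type v} [AddCommGroup M] [Module k M] [AddCommGroup N] [Module k N]
    [Module.Finite k M] [Module.Finite k N] (β : M →ₗ[k] N →ₗ[k] I) :
    IsFiniteLength k (M ⧸ LinearMap.ker β) := by
  have art (L : Submodule k I) (hL : L.FG) : IsArtinian k L := by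
    induction L, hL using Submodule.fg_induction with
    | singleton x => exact hI x
    | sup A B _ _ hA hB => exact isArtinian_sup A B
  obtain ⟨S, hS⟩ := (Module.Finite.fg_top : (⊤ : Submodule k N).FG)
  have : ∀ s : S, IsArtinian k (LinearMap.range (β.flip s)) := fun s =>
    art _ (Module.Finite.iff_fg.mp inferInstance)
  let ev : M →ₗ[k] (∀ s : S, LinearMap.range (β.flip s)) :=
    LinearMap.pi fun s => (β.flip s).rangeRestrict
  have hker : LinearMap.ker ev = LinearMap.ker β := by
    ext x
    rw [LinearMap.mem_ker, LinearMap.mem_ker]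
    constructor
    · intro hx
      refine LinearMap.ext_on hS fun s hs => ?_
      exact congrArg Subtype.val (congrFun hx ⟨s, hs⟩)
    · intro hx
      funext s
      exact Subtype.ext (LinearMap.congr_fun hx s)
  rw [isFiniteLength_iff_isNoetherian_isArtinian]
  refine ⟨inferInstance, ?_⟩
  rw [← hker]
  exact isArtinian_of_linearEquiv ev.quotKerEquivRange.symm

/-- A linear form vanishing on the left kernel of a bilinear form with values in a Matlis dualizing
module is given by pairing with an element. -/
theorem exists_eq_pairing [IsNoetherianRing k] {I : Type v} [AddCommGroup I] [Module k I]
    (hart : ∀ y : I, IsArtinian k (Submodule.span k {y}))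
    (hsimple : ∀ (S : Type v) [AddCommGroup S] [Module k S] [IsSimpleModule k S],
      Module.length k (S →ₗ[k] I) ≤ 1)
    {M N : Type v} [AddCommGroup M] [Module k M] [AddCommGroup N] [Module k N]
    [Module.Finite k M] [Module.Finite k N] (β : M →ₗ[k] N →ₗ[k] I)
    (δ : M →ₗ[k] I) (hδ : LinearMap.ker β ≤ LinearMap.ker δ) :
    ∃ n, ∀ m, δ m = β m n := by
  let Φ : (M ⧸ LinearMap.ker β) →ₗ[k] (N ⧸ LinearMap.ker β.flip) →ₗ[k] I :=
    (LinearMap.ker β).liftQ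
      ((LinearMap.ker β.flip).liftQ β.flip le_rfl).flip fun x hx => by
        rw [LinearMap.mem_ker] at hx ⊢
        ext n
        simpa using LinearMap.congr_fun hx n
  have hΦ (m : M) (n : N) : Φ (Submodule.Quotient.mk m) (Submodule.Quotient.mk n) = β m n := rfl
  have inj : Function.Injective Φ := by
    rw [← LinearMap.ker_eq_bot, LinearMap.ker_eq_bot']
    intro x hx
    obtain ⟨m, rfl⟩ := Submodule.Quotient.mk_surjective _ x
    rw [Submodule.Quotient.mk_eq_zero, LinearMap.mem_ker]
    ext n
    rw [← hΦ, hx]; rfl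
  have inj' : Function.Injective Φ.flip := by
    rw [← LinearMap.ker_eq_bot, LinearMap.ker_eq_bot']
    intro x hx
    obtain ⟨n, rfl⟩ := Submodule.Quotient.mk_surjective _ x
    rw [Submodule.Quotient.mk_eq_zero, LinearMap.mem_ker]
    ext m
    exact LinearMap.congr_fun hx (Submodule.Quotient.mk m)
  have fin := isFiniteLength_quotient_ker hart β
  have fin' := isFiniteLength_quotient_ker hart β.flip
  have surj : Function.Surjective Φ.flip :=
    surjective_of_injective_of_length_le _ inj' (Module.length_ne_top_iff.mpr fin')
      ((length_hom_le hsimple fin).trans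
        ((Module.length_le_of_injective Φ inj).trans (length_hom_le hsimple fin')))
  obtain ⟨x, hx⟩ := surj ((LinearMap.ker β).liftQ δ hδ)
  obtain ⟨n, rfl⟩ := Submodule.Quotient.mk_surjective _ x
  exact ⟨n, fun m => (LinearMap.congr_fun hx (Submodule.Quotient.mk m)).symm⟩

section Envelope

variable {m : MaximalSpectrum k} {E : Type v} [AddCommGroup E] [Module k E]
  (f : (k ⧸ m.asIdeal) →ₗ[k] E)
  (hess : ∀ N : Submodule k E, N ⊓ LinearMap.range f = ⊥ → N = ⊥)

include hess in
/-- Every nonzero element of an essential extension of `k / m` has a nonzero multiple in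
`k / m`. -/
theorem exists_smul_mem_range {z : E} (hz : z ≠ 0) :
    ∃ a : k, a • z ≠ 0 ∧ a • z ∈ LinearMap.range f := by
  by_contra! h
  refine hz ((Submodule.span_singleton_eq_bot (R := k)).mp (hess _ (eq_bot_iff.mpr ?_)))
  rintro w ⟨hw, hw'⟩
  obtain ⟨a, rfl⟩ := Submodule.mem_span_singleton.mp hw
  by_contra hne
  exact h a hne hw'

theorem smul_eq_zero_of_mem_range {z : E} (hz : z ∈ LinearMap.range f) {c : k}
    (hc : c ∈ m.asIdeal) : c • z = 0 := by
  obtain ⟨u, rfl⟩ := hz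
  obtain ⟨u, rfl⟩ := Ideal.Quotient.mk_surjective u
  rw [← map_smul, Algebra.smul_def, Ideal.Quotient.algebraMap_eq, ← map_mul,
    Ideal.Quotient.eq_zero_iff_mem.mpr (m.asIdeal.mul_mem_right _ hc), map_zero]

include hess in
/-- An associated prime of `E(k/m)` is `m`. -/
theorem eq_asIdeal_of_isPrime {z : E} {p : Ideal k} (hp : p.IsPrime)
    (hpz : ∀ c : k, c ∈ p ↔ c • z = 0) : p = m.asIdeal := by
  have hz : z ≠ 0 := fun h => hp.ne_top ((Ideal.eq_top_iff_one p).mpr (by simp [hpz, h]))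
  obtain ⟨a, ha, ha'⟩ := exists_smul_mem_range f hess hz
  refine (m.isMaximal.eq_of_le hp.ne_top fun c hc => ?_).symm
  refine (hp.mem_or_mem ((hpz (c * a)).mpr ?_)).resolve_right fun h => ha ((hpz a).mp h)
  rw [mul_smul, smul_eq_zero_of_mem_range f ha' hc]

include hess in
/-- The cyclic submodules of `E(k/m)` are artinian. -/
theorem isArtinian_span_singleton_of_essential [IsNoetherianRing k] (y : E) :
    IsArtinian k (Submodule.span k {y}) := by
  let J : Ideal k := LinearMap.ker (LinearMap.toSpanSingleton k E y)
  have e : (k ⧸ J) ≃ₗ[k] Submodule.span k {y} :=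
    (LinearMap.toSpanSingleton k E y).quotKerEquivRange.trans
      (LinearEquiv.ofEq _ _ (LinearMap.range_toSpanSingleton y))
  have : Ring.KrullDimLE 0 (k ⧸ J) := by
    rw [Ideal.krullDimLE_zero_quotient_iff_forall_minimalPrimes_isMaximal]
    intro p hp
    have hp' : p ∈ (Module.annihilator k (k ⧸ J)).minimalPrimes := by
      rwa [Ideal.annihilator_quotient]
    obtain ⟨hpp, x, hx⟩ := Submodule.isAssociatedPrime_iff.mp <|
      Module.associatedPrimes.minimalPrimes_annihilator_subset_associatedPrimes k (k ⧸ J) hp'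
    rw [eq_asIdeal_of_isPrime f hess (z := (e x : E)) hpp fun c => ?_]
    · exact m.isMaximal
    · rw [hx, Submodule.mem_colon_singleton, Submodule.mem_bot, ← e.map_eq_zero_iff, map_smul,
        ← Submodule.coe_eq_zero, Submodule.coe_smul]
  have : IsArtinianRing (k ⧸ J) := IsNoetherianRing.isArtinianRing_of_krullDimLE_zero
  have : IsArtinian k (k ⧸ J) := isArtinian_of_surjective_algebraMap (M := k ⧸ J) (R := k ⧸ J)
    Ideal.Quotient.mk_surjective
  exact isArtinian_of_linearEquiv e

include hess in
/-- The `m'`-torsion of `E(k/m)` is concentrated in `m = m'` and contained in `k / m`. -/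
theorem torsion_of_essential {m' : MaximalSpectrum k} {z : E} (hz : z ≠ 0)
    (hm' : ∀ c ∈ m'.asIdeal, c • z = 0) : m' = m ∧ z ∈ LinearMap.range f := by
  have hmm : m'.asIdeal = m.asIdeal := by
    refine eq_asIdeal_of_isPrime f hess (z := z) m'.isMaximal.isPrime fun c => ⟨hm' c, fun hc => ?_⟩
    by_contra hcm
    obtain ⟨b, u, hu, h1⟩ := m'.isMaximal.exists_inv hcm
    apply hz
    rw [← one_smul k z, ← h1, add_smul, mul_smul, hc, hm' u hu, smul_zero, add_zero]
  obtain ⟨a, ha, ha'⟩ := exists_smul_mem_range f hess hz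
  have ham : a ∉ m'.asIdeal := fun h => ha (hm' a h)
  obtain ⟨b, u, hu, h1⟩ := m'.isMaximal.exists_inv ham
  refine ⟨MaximalSpectrum.ext hmm, ?_⟩
  rw [← one_smul k z, ← h1, add_smul, mul_smul, hm' u hu, add_zero]
  exact Submodule.smul_mem _ b ha'

end Envelope

section DirectSum

variable {E : MaximalSpectrum k → Type v} [∀ m, AddCommGroup (E m)] [∀ m, Module k (E m)]
  (f : ∀ m : MaximalSpectrum k, (k ⧸ m.asIdeal) →ₗ[k] E m)
  (hess : ∀ m, ∀ N : Submodule k (E m), N ⊓ LinearMap.range (f m) = ⊥ → N = ⊥)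

include hess in
theorem isArtinian_span_singleton_directSum [IsNoetherianRing k]
    (y : DirectSum (MaximalSpectrum k) E) : IsArtinian k (Submodule.span k {y}) := by
  classical
  induction y using DirectSum.induction_on with
  | zero => rw [Submodule.span_zero_singleton]; infer_instance
  | of m y =>
    have := isArtinian_span_singleton_of_essential (f m) (hess m) y
    change IsArtinian k (Submodule.span k {DirectSum.lof k _ E m y})
    rw [← Set.image_singleton, ← Submodule.map_span]
    exact isArtinian_of_surjective _ _ (LinearMap.submoduleMap_surjective _ _)
  | add y z hy hz =>
    have hle : Submodule.span k {y + z} ≤ Submodule.span k {y} ⊔ Submodule.span k {z} := by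
      rw [Submodule.span_singleton_le_iff_mem]
      exact Submodule.add_mem_sup (Submodule.mem_span_singleton_self y)
        (Submodule.mem_span_singleton_self z)
    exact isArtinian_of_le hle

include hess in
theorem length_hom_directSum_le_one (S : Type v) [AddCommGroup S] [Module k S]
    [IsSimpleModule k S] :
    Module.length k (S →ₗ[k] DirectSum (MaximalSpectrum k) E) ≤ 1 := by
  classical
  have := IsSimpleModule.nontrivial k S
  obtain ⟨s, hs⟩ := exists_ne (0 : S)
  have hmax : Ideal.IsMaximal (LinearMap.ker (LinearMap.toSpanSingleton k S s)) :=
    IsSimpleModule.ker_toSpanSingleton_isMaximal k hs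
  let m : MaximalSpectrum k := ⟨_, hmax⟩
  have : IsSimpleModule k (k ⧸ m.asIdeal) := isSimpleModule_iff_isCoatom.mpr m.isMaximal.out
  let g := (DirectSum.lof k _ E m).comp (f m)
  let ev : (S →ₗ[k] DirectSum (MaximalSpectrum k) E) →ₗ[k] DirectSum (MaximalSpectrum k) E :=
    LinearMap.applyₗ s
  have hev (φ) : ev φ ∈ LinearMap.range g := by
    have hkill (m' : MaximalSpectrum k) (c : k) (hc : c ∈ m.asIdeal) : c • (φ s m') = 0 := by
      have hcs : c • s = 0 := hc
      rw [← DirectSum.smul_apply, ← map_smul, hcs, map_zero, DirectSum.zero_apply]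
    have hmem : φ s m ∈ LinearMap.range (f m) := by
      by_cases h0 : φ s m = 0
      · rw [h0]; exact zero_mem _
      · exact (torsion_of_essential (f m) (hess m) h0 (hkill m)).2
    obtain ⟨u, hu⟩ := hmem
    refine ⟨u, ?_⟩
    refine DFinsupp.ext fun m' => ?_
    change (DirectSum.lof k _ E m (f m u)) m' = φ s m'
    rw [hu]
    by_cases hmm : m = m'
    · subst hmm; exact DirectSum.lof_apply k m _
    · rw [DirectSum.lof_eq_of, DirectSum.of_eq_of_ne _ _ _ (Ne.symm hmm)]
      by_contra h0
      exact hmm (torsion_of_essential (f m') (hess m') (Ne.symm h0) (hkill m')).1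
  have inj : Function.Injective (ev.codRestrict _ hev) := by
    intro φ ψ h
    refine LinearMap.ext_on (IsSimpleModule.span_singleton_eq_top k hs) ?_
    rintro _ rfl
    exact congrArg Subtype.val h
  calc Module.length k (S →ₗ[k] DirectSum (MaximalSpectrum k) E)
      ≤ Module.length k (LinearMap.range g) := Module.length_le_of_injective _ inj
    _ ≤ Module.length k (k ⧸ m.asIdeal) :=
      Module.length_le_of_surjective _ g.surjective_rangeRestrict
    _ = 1 := Module.length_eq_one k _

end DirectSum

end Matlis

/-- The nonunits of a (possibly noncommutative) local ring lie in its Jacobson radical. -/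
theorem mem_jacobson_bot_of_not_isUnit {R : Type*} [Ring R] [IsLocalRing R] {r : R}
    (hr : ¬ IsUnit r) : r ∈ (⊥ : Ideal R).jacobson := by
  rw [Ideal.mem_jacobson_iff]
  intro y
  have hyr : ¬ IsUnit (y * r) := by
    rintro ⟨w, hw⟩
    have hl : (↑w⁻¹ * y) * r = 1 := by rw [mul_assoc, ← hw, Units.inv_mul]
    rcases IsLocalRing.isUnit_or_isUnit_of_isUnit_add (a := r * (↑w⁻¹ * y))
        (b := 1 - r * (↑w⁻¹ * y)) (by simp) with h | h
    · obtain ⟨t, ht⟩ := h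
      refine hr ⟨⟨r, ↑w⁻¹ * y, ?_, hl⟩, rfl⟩
      apply (Units.isUnit t).mul_left_cancel
      rw [ht, mul_one, mul_assoc r, ← mul_assoc (↑w⁻¹ * y) r, hl, one_mul]
    · have h0 : (1 - r * (↑w⁻¹ * y)) * r = 0 := by rw [sub_mul, mul_assoc r, hl]; simp
      have hr0 : r = 0 := by simpa using h.mul_left_cancel (h0.trans (mul_zero _).symm)
      simp [hr0] at hl
  have h1 : IsUnit (1 + y * r) :=
    (IsLocalRing.isUnit_or_isUnit_of_isUnit_add (a := 1 + y * r) (b := -(y * r))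
      (by simp)).resolve_right fun h => hyr (by simpa using h.neg)
  obtain ⟨w, hw⟩ := h1
  refine ⟨↑w⁻¹, ?_⟩
  have : (↑w⁻¹ : R) * y * r + ↑w⁻¹ - 1 = ↑w⁻¹ * (1 + y * r) - 1 := by noncomm_ring
  rw [this, ← hw, Units.inv_mul, sub_self]
  exact zero_mem _

namespace Paper

section Serre

variable {k : Type v} [CommRing k] {I : Type v} [AddCommGroup I] [Module k I]
  {C : Type u} [Category.{v} C] [Preadditive C] [CategoryTheory.Linear k C]
  {X SX : C} (D : SerreDualityData k I X SX)

/-- The form on `Hom(X, SX)` corresponding to the identity of `SX`. -/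
noncomputable def SerreDualityData.trace : (X ⟶ SX) →ₗ[k] I := (D.equiv SX).symm (𝟙 SX)

include D in
/-- A morphism out of `SX` is a split monomorphism as soon as it is injective on `Hom(X, -)`. -/
theorem SerreDualityData.isSplitMono_of_injective (hI : Module.Injective k I) {Y : C} (f : SX ⟶ Y)
    (hf : ∀ a : X ⟶ SX, a ≫ f = 0 → a = 0) : IsSplitMono f := by
  obtain ⟨φ, hφ⟩ := hI.out (Linear.rightComp k X f)
    ((injective_iff_map_eq_zero _).mpr hf) D.trace
  refine ⟨⟨⟨D.equiv Y φ, ?_⟩⟩⟩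
  rw [← D.naturality, show φ.comp (Linear.rightComp k X f) = D.trace from LinearMap.ext hφ,
    SerreDualityData.trace, LinearEquiv.apply_symm_apply]

theorem form_eq_zero_of_not_isIso [IsLocalRing (End X)] {γ : (X ⟶ X) →ₗ[k] I}
    (hrad : ∀ r : End X, r ∈ (⊥ : Ideal (End X)).jacobson → γ (r : X ⟶ X) = 0)
    (r : X ⟶ X) (hr : ¬ IsIso r) : γ r = 0 :=
  hrad r (mem_jacobson_bot_of_not_isUnit fun h => hr ((isUnit_iff_isIso r).mp h))

/-- The morphism `X ⟶ SX` attached to a form on `End X` vanishing on the radical is annihilated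
by every morphism into `X` that is not a split epimorphism. -/
theorem SerreDualityData.comp_equiv_eq_zero [IsLocalRing (End X)] {γ : (X ⟶ X) →ₗ[k] I}
    (hrad : ∀ r : End X, r ∈ (⊥ : Ideal (End X)).jacobson → γ (r : X ⟶ X) = 0)
    {W : C} (h : W ⟶ X) (hh : ¬ IsSplitEpi h) : h ≫ D.equiv X γ = 0 := by
  rw [← D.naturality, LinearEquiv.map_eq_zero_iff]
  ext g
  refine form_eq_zero_of_not_isIso hrad (g ≫ h) fun hiso => hh ⟨⟨⟨inv (g ≫ h) ≫ g, ?_⟩⟩⟩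
  rw [Category.assoc, IsIso.inv_hom_id]

/-- The morphism `X ⟶ SX` attached to a nonzero form on `End X` vanishing on the radical is
annihilated by every morphism out of `SX` that is not a split monomorphism. -/
theorem SerreDualityData.equiv_comp_eq_zero [IsNoetherianRing k] [IsLocalRing (End X)]
    [Module.Finite k (X ⟶ X)] (hI : Module.Injective k I)
    (hart : ∀ y : I, IsArtinian k (Submodule.span k {y}))
    (hsimple : ∀ (S : Type v) [AddCommGroup S] [Module k S] [IsSimpleModule k S],
      Module.length k (S →ₗ[k] I) ≤ 1) {γ : (X ⟶ X) →ₗ[k] I}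
    (hrad : ∀ r : End X, r ∈ (⊥ : Ideal (End X)).jacobson → γ (r : X ⟶ X) = 0)
    {Y : C} (f : SX ⟶ Y) (hf : ¬ IsSplitMono f) : D.equiv X γ ≫ f = 0 := by
  contrapose! hf
  refine D.isSplitMono_of_injective hI f fun a ha => ?_
  obtain ⟨α, rfl⟩ := (D.equiv X).surjective a
  by_contra hα
  rw [LinearEquiv.map_eq_zero_iff] at hα
  let β : (X ⟶ X) →ₗ[k] (X ⟶ X) →ₗ[k] I := (Linear.comp (S := k) X X X).compr₂ α
  have hβ : LinearMap.ker β ≤ LinearMap.ker γ := fun r hr => by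
    refine form_eq_zero_of_not_isIso hrad r fun hiso => hα (LinearMap.ext fun x => ?_)
    have : α (r ≫ inv r ≫ x) = 0 := LinearMap.congr_fun hr (inv r ≫ x)
    rwa [IsIso.hom_inv_id_assoc] at this
  obtain ⟨x, hx⟩ := exists_eq_pairing hart hsimple β γ hβ
  apply hf
  rw [show γ = α.comp (Linear.rightComp k X x) from LinearMap.ext hx, D.naturality,
    Category.assoc, ha, comp_zero]

end Serre

end Paper

open Paper in
/-- Assume `k` is a commutative noetherian ring and
`I = ⊕_{m ∈ MaxSpec k} E(k/m)`.  Let `S : X → T` be a partial Serre functor with respect to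
this `I`.  If `X` has local endomorphism ring which is finitely generated as a `k`-module,
then the triangle `S X⟦-1⟧ → N → X → S X` obtained by completing the morphism `X → S X`
corresponding to a nonzero `k`-linear form on `End X` vanishing on `rad End X` is an almost
split triangle. -/
theorem serre_triangle_is_almost_split
    (k : Type v) [CommRing k] [IsNoetherianRing k]
    (Ek : MaximalSpectrum k → Type v) [∀ m, AddCommGroup (Ek m)] [∀ m, Module k (Ek m)]
    (henv : ∀ m : MaximalSpectrum k, Module.Injective k (Ek m) ∧
      ∃ f : (k ⧸ m.asIdeal) →ₗ[k] Ek m, Function.Injective f ∧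
        ∀ N : Submodule k (Ek m), N ⊓ LinearMap.range f = ⊥ → N = ⊥)
    {C : Type u} [Category.{v} C] [Preadditive C]
    [CategoryTheory.Linear k C] [HasZeroObject C] [HasShift C ℤ]
    [∀ n : ℤ, (shiftFunctor C n).Additive] [Pretriangulated C]
    (X SX : C) (D : SerreDualityData k (DirectSum (MaximalSpectrum k) Ek) X SX)
    [IsLocalRing (End X)] [Module.Finite k (X ⟶ X)]
    (γ : (X ⟶ X) →ₗ[k] DirectSum (MaximalSpectrum k) Ek) (hγ : γ ≠ 0)
    (hrad : ∀ r : End X, r ∈ (⊥ : Ideal (End X)).jacobson → γ (r : X ⟶ X) = 0)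
    (N : C) (d : SX⟦(-1 : ℤ)⟧ ⟶ N) (n : N ⟶ X)
    (hΔ : Triangle.mk d n (D.equiv X γ ≫ (unshiftShiftIso SX).inv) ∈ distTriang C) :
    IsAlmostSplitTriangle (Triangle.mk d n (D.equiv X γ ≫ (unshiftShiftIso SX).inv)) := by
  choose hinj f _ hess using henv
  have hI := injective_directSum Ek hinj
  have hart := isArtinian_span_singleton_directSum f hess
  have hsimple := fun (S : Type v) [AddCommGroup S] [Module k S] [IsSimpleModule k S] =>
    length_hom_directSum_le_one f hess S
  have hne : D.equiv X γ ≫ (unshiftShiftIso SX).inv ≠ 0 := by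
    intro h
    rw [Preadditive.IsIso.comp_right_eq_zero, LinearEquiv.map_eq_zero_iff] at h
    exact hγ h
  refine ⟨⟨fun hd => hne ?_, fun W (h : SX⟦(-1 : ℤ)⟧ ⟶ W) hh => ?_⟩,
    fun hn => hne ?_, fun W (h : W ⟶ X) hh => ?_⟩
  · exact Triangle.mor₃_eq_zero_of_mono₁ _ hΔ inferInstance
  · have hsplit : ¬ IsSplitMono ((unshiftShiftIso SX).inv ≫ h⟦(1 : ℤ)⟧') := by
      intro hs
      have : IsSplitMono (h⟦(1 : ℤ)⟧') := by
        rw [← Iso.hom_inv_id_assoc (unshiftShiftIso SX) (h⟦(1 : ℤ)⟧')]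
        infer_instance
      exact hh (((shiftFunctor C (1 : ℤ)).isSplitMono_iff h).mp this)
    have h0 : (D.equiv X γ ≫ (unshiftShiftIso SX).inv) ≫ h⟦(1 : ℤ)⟧' = 0 :=
      (Category.assoc _ _ _).trans (D.equiv_comp_eq_zero hI hart hsimple hrad _ hsplit)
    obtain ⟨g, hg⟩ : ∃ g : N⟦(1 : ℤ)⟧ ⟶ W⟦(1 : ℤ)⟧, h⟦(1 : ℤ)⟧' = (-d⟦(1 : ℤ)⟧') ≫ g :=
      Triangle.yoneda_exact₃ _ (rot_of_distTriang _ hΔ) (h⟦(1 : ℤ)⟧') h0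
    refine ⟨-(shiftFunctor C (1 : ℤ)).preimage g, ?_⟩
    change d ≫ _ = h
    apply (shiftFunctor C (1 : ℤ)).map_injective
    rw [hg, Preadditive.comp_neg, Functor.map_neg, Functor.map_comp, Functor.map_preimage,
      Preadditive.neg_comp]
  · exact Triangle.mor₃_eq_zero_of_epi₂ _ hΔ inferInstance
  · have h0 : h ≫ D.equiv X γ ≫ (unshiftShiftIso SX).inv = 0 := by
      rw [← Category.assoc, D.comp_equiv_eq_zero hrad h hh, zero_comp]
    obtain ⟨g, hg⟩ := Triangle.coyoneda_exact₃ _ hΔ h h0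
    exact ⟨g, hg.symm⟩
end

section
/- Let X and Y be objects of a triangulated category T such that End(X) and End(Y) are local rings, let f : X → Y be a nonzero morphism, and let Δ : Y[−1] →d E →e X →f Y be the triangle ending in f. Then the following are equivalent: (i) Δ is an almost split triangle; (ii) d is left almost split; (iii) e is right almost split; (iv) gf = 0 whenever g is not a split monomorphism; (v) fh = 0 whenever h is not a split epimorphism; (vi) for each nonzero t : T → Y there is s : X → T with ts = f; (vii) for each nonzero s : X → S there is t : S → Y with ts = f; (viii) composition from X to Y is non-degenerate and f·rad End(X) = 0; (ix) composition from X to Y is non-degenerate and rad End(Y)·f = 0; (x) composition from X to Y is non-degenerate and every nonzero End(X)-submodule of T(X, Y) contains f; (xi) composition from X to Y is non-degenerate and every nonzero End(Y)^op-submodule of T(X, Y) contains f. -/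
open CategoryTheory CategoryTheory.Limits CategoryTheory.Pretriangulated

universe v u

namespace Paper

/-- Composition from `X` to `Y` is non-degenerate. -/
def NondegComp {C : Type u} [Category.{v} C] [Preadditive C] (X Y : C) : Prop :=
  (∀ ⦃T : C⦄ (f : X ⟶ T), f ≠ 0 → ∃ g : T ⟶ Y, f ≫ g ≠ 0) ∧
  (∀ ⦃T : C⦄ (g : T ⟶ Y), g ≠ 0 → ∃ f : X ⟶ T, f ≫ g ≠ 0)

end Paper

namespace IsLocalRing

variable {R : Type*} [Ring R] [IsLocalRing R]

theorem isDedekindFiniteMonoid : IsDedekindFiniteMonoid R where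
  mul_eq_one_symm {a b} hab := by
    have hidem : b * a * (b * a) = b * a := by
      rw [mul_assoc, ← mul_assoc a, hab, one_mul]
    rcases isUnit_or_isUnit_of_add_one (add_sub_cancel (b * a) 1) with h | h
    · exact h.mul_left_cancel (by rw [hidem, mul_one])
    · have hba : b * a = 0 := h.mul_left_cancel (by rw [sub_mul, one_mul, hidem, sub_self, mul_zero])
      have h10 : (1 : R) = 0 := by
        calc (1 : R) = a * b * (a * b) := by rw [hab, one_mul]
          _ = a * (b * a) * b := by simp only [mul_assoc]
          _ = 0 := by rw [hba, mul_zero, zero_mul]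
      exact absurd h10 one_ne_zero

theorem mem_jacobson_bot_iff_not_isUnit {r : R} :
    r ∈ (⊥ : Ideal R).jacobson ↔ ¬ IsUnit r := by
  have := isDedekindFiniteMonoid (R := R)
  simp only [Ideal.mem_jacobson_iff, Ideal.mem_bot]
  constructor
  · rintro h ⟨u, rfl⟩
    obtain ⟨z, hz⟩ := h (-(u⁻¹ : Rˣ))
    simp [mul_assoc] at hz
  · intro hr y
    have hy : ¬ IsUnit (-(y * r)) := fun h => hr <| by
      obtain ⟨w, hw⟩ := h.exists_left_inv
      have hw' : -(w * y) * r = 1 := by rw [← hw]; simp [mul_assoc]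
      exact IsUnit.of_mul_eq_one _ (mul_eq_one_comm.mp hw')
    obtain ⟨w, hw⟩ := ((isUnit_or_isUnit_of_add_one (add_sub_cancel (-(y * r)) 1)).resolve_left
      hy).exists_left_inv
    refine ⟨w, ?_⟩
    rw [sub_eq_zero, ← hw]
    noncomm_ring

end IsLocalRing

namespace Paper

variable {C : Type u} [Category.{v} C]

section Preadditive

variable {X Y : C}

theorem isSplitEpi_of_isUnit_comp {W : C} {s : X ⟶ W} {h : W ⟶ X}
    (hu : IsUnit (show End X from s ≫ h)) : IsSplitEpi h := by
  obtain ⟨w, hw⟩ := hu.exists_right_inv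
  have hw : w ≫ s ≫ h = 𝟙 X := hw
  exact ⟨⟨⟨w ≫ s, by simpa using hw⟩⟩⟩

theorem isSplitMono_of_isUnit_comp {Z : C} {g : Y ⟶ Z} {t : Z ⟶ Y}
    (hu : IsUnit (show End Y from g ≫ t)) : IsSplitMono g := by
  obtain ⟨w, hw⟩ := hu.exists_left_inv
  have hw : (g ≫ t) ≫ w = 𝟙 Y := hw
  exact ⟨⟨⟨t ≫ w, by simpa using hw⟩⟩⟩

variable [Preadditive C]

theorem isSplitEpi_end_iff_isUnit [IsLocalRing (End X)] {r : End X} :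
    IsSplitEpi (r : X ⟶ X) ↔ IsUnit r := by
  have := IsLocalRing.isDedekindFiniteMonoid (R := End X)
  refine ⟨fun h => ?_, fun h => isSplitEpi_of_isUnit_comp (s := 𝟙 X) ?_⟩
  · obtain ⟨⟨s, hs⟩⟩ := h
    exact IsUnit.of_mul_eq_one (s : End X) hs
  · rwa [Category.id_comp]

theorem isSplitMono_end_iff_isUnit [IsLocalRing (End Y)] {r : End Y} :
    IsSplitMono (r : Y ⟶ Y) ↔ IsUnit r := by
  have := IsLocalRing.isDedekindFiniteMonoid (R := End Y)
  refine ⟨fun h => ?_, fun h => isSplitMono_of_isUnit_comp (t := 𝟙 Y) ?_⟩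
  · obtain ⟨⟨s, hs⟩⟩ := h
    have hs : (show End Y from s) * r = 1 := hs
    exact IsUnit.of_mul_eq_one _ (mul_eq_one_comm.mp hs)
  · rwa [Category.comp_id]

variable {f : X ⟶ Y}

theorem isSplitEpi_of_comp_comp_eq_self [IsLocalRing (End X)] (hf : f ≠ 0) {W : C}
    {s : X ⟶ W} {h : W ⟶ X} (hs : s ≫ h ≫ f = f) : IsSplitEpi h := by
  rcases IsLocalRing.isUnit_or_isUnit_of_add_one
    (add_sub_cancel (show End X from s ≫ h) 1) with hu | hu
  · exact isSplitEpi_of_isUnit_comp hu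
  · obtain ⟨w, hw⟩ := hu.exists_right_inv
    have hw : w ≫ (𝟙 X - s ≫ h) = 𝟙 X := hw
    refine absurd ?_ hf
    rw [← Category.id_comp f, ← hw]
    simp [hs]

theorem isSplitMono_of_comp_comp_eq_self [IsLocalRing (End Y)] (hf : f ≠ 0) {Z : C}
    {g : Y ⟶ Z} {t : Z ⟶ Y} (ht : (f ≫ g) ≫ t = f) : IsSplitMono g := by
  rcases IsLocalRing.isUnit_or_isUnit_of_add_one
    (add_sub_cancel (show End Y from g ≫ t) 1) with hu | hu
  · exact isSplitMono_of_isUnit_comp hu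
  · obtain ⟨w, hw⟩ := hu.exists_left_inv
    have hw : (𝟙 Y - g ≫ t) ≫ w = 𝟙 Y := hw
    have ht' : f ≫ g ≫ t = f := by simpa using ht
    refine absurd ?_ hf
    rw [← Category.comp_id f, ← hw, ← Category.assoc, Preadditive.comp_sub, ht']
    simp

theorem nondegComp_of_forall_exists_comp_eq (hf : f ≠ 0)
    (h₁ : ∀ ⦃T : C⦄ (t : T ⟶ Y), t ≠ 0 → ∃ s : X ⟶ T, s ≫ t = f)
    (h₂ : ∀ ⦃S : C⦄ (s : X ⟶ S), s ≠ 0 → ∃ t : S ⟶ Y, s ≫ t = f) : NondegComp X Y :=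
  ⟨fun _ s hs => (h₂ s hs).imp fun _ h => h.trans_ne hf,
    fun _ t ht => (h₁ t ht).imp fun _ h => h.trans_ne hf⟩

theorem NondegComp.comp_eq_zero_of_not_isSplitEpi [IsLocalRing (End X)] (hn : NondegComp X Y)
    (hr : ∀ r : End X, r ∈ (⊥ : Ideal (End X)).jacobson → (r : X ⟶ X) ≫ f = 0)
    {W : C} {h : W ⟶ X} (hh : ¬ IsSplitEpi h) : h ≫ f = 0 := by
  by_contra hne
  obtain ⟨k, hk⟩ := hn.2 _ hne
  refine hk ?_
  rw [← Category.assoc]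
  exact hr (k ≫ h)
    (IsLocalRing.mem_jacobson_bot_iff_not_isUnit.2 fun hu => hh (isSplitEpi_of_isUnit_comp hu))

theorem NondegComp.comp_eq_zero_of_not_isSplitMono [IsLocalRing (End Y)] (hn : NondegComp X Y)
    (hr : ∀ r : End Y, r ∈ (⊥ : Ideal (End Y)).jacobson → f ≫ (r : Y ⟶ Y) = 0)
    {Z : C} {g : Y ⟶ Z} (hg : ¬ IsSplitMono g) : f ≫ g = 0 := by
  by_contra hne
  obtain ⟨k, hk⟩ := hn.1 _ hne
  refine hk ?_
  rw [Category.assoc]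
  exact hr (g ≫ k)
    (IsLocalRing.mem_jacobson_bot_iff_not_isUnit.2 fun hu => hg (isSplitMono_of_isUnit_comp hu))

theorem NondegComp.exists_comp_eq_of_forall_mem_left (hn : NondegComp X Y)
    (hS : ∀ S : AddSubgroup (X ⟶ Y), (∀ (r : X ⟶ X), ∀ g ∈ S, r ≫ g ∈ S) → S ≠ ⊥ → f ∈ S)
    {T : C} {t : T ⟶ Y} (ht : t ≠ 0) : ∃ s : X ⟶ T, s ≫ t = f := by
  obtain ⟨k, hk⟩ := hn.2 t ht
  refine hS (Preadditive.rightComp X t).range ?_ fun hbot => hk ?_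
  · rintro r _ ⟨s, rfl⟩
    exact ⟨r ≫ s, Category.assoc _ _ _⟩
  · exact (AddSubgroup.eq_bot_iff_forall _).1 hbot _ ⟨k, rfl⟩

theorem NondegComp.exists_comp_eq_of_forall_mem_right (hn : NondegComp X Y)
    (hS : ∀ S : AddSubgroup (X ⟶ Y), (∀ (r : Y ⟶ Y), ∀ g ∈ S, g ≫ r ∈ S) → S ≠ ⊥ → f ∈ S)
    {T : C} {s : X ⟶ T} (hs : s ≠ 0) : ∃ t : T ⟶ Y, s ≫ t = f := by
  obtain ⟨k, hk⟩ := hn.1 s hs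
  refine hS (Preadditive.leftComp Y s).range ?_ fun hbot => hk ?_
  · rintro r _ ⟨t, rfl⟩
    exact ⟨t ≫ r, (Category.assoc _ _ _).symm⟩
  · exact (AddSubgroup.eq_bot_iff_forall _).1 hbot _ ⟨k, rfl⟩

end Preadditive

theorem unshiftShiftIso_inv_naturality [HasShift C ℤ] {Y Z : C} (g : Y ⟶ Z) :
    (unshiftShiftIso Y).inv ≫ (g⟦(-1 : ℤ)⟧')⟦(1 : ℤ)⟧' = g ≫ (unshiftShiftIso Z).inv :=
  ((shiftFunctorCompIsoId C (-1 : ℤ) (1 : ℤ) (by omega)).inv.naturality g).symm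

section Pretriangulated

variable [Preadditive C] [HasZeroObject C] [HasShift C ℤ]
  [∀ n : ℤ, (shiftFunctor C n).Additive] [Pretriangulated C] {X Y : C} {f : X ⟶ Y}

theorem forall_not_isSplitMono_comp_eq_zero_iff :
    (∀ ⦃Z : C⦄ (g : Y ⟶ Z), ¬ IsSplitMono g → f ≫ g = 0) ↔
      ∀ ⦃T : C⦄ (t : T ⟶ Y), t ≠ 0 → ∃ s : X ⟶ T, s ≫ t = f := by
  refine ⟨fun h T t ht => ?_, fun h Z g hg => ?_⟩
  · obtain ⟨Z, g, k, hT⟩ := distinguished_cocone_triangle t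
    have htg : t ≫ g = 0 := comp_distTriang_mor_zero₁₂ _ hT
    obtain ⟨s, hs⟩ := Triangle.coyoneda_exact₂ _ hT f
      (h g fun _ => ht ((cancel_mono g).1 (by rw [htg, zero_comp])))
    exact ⟨s, hs.symm⟩
  · obtain ⟨T, t, k, hT⟩ := distinguished_cocone_triangle₁ g
    have htg : t ≫ g = 0 := comp_distTriang_mor_zero₁₂ _ hT
    obtain ⟨s, rfl⟩ := h t fun ht => hg <|
      have : Mono g := Triangle.mono₂ _ hT ht
      isSplitMono_of_mono g
    rw [Category.assoc, htg, comp_zero]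

theorem forall_not_isSplitEpi_comp_eq_zero_iff :
    (∀ ⦃W : C⦄ (h : W ⟶ X), ¬ IsSplitEpi h → h ≫ f = 0) ↔
      ∀ ⦃S : C⦄ (s : X ⟶ S), s ≠ 0 → ∃ t : S ⟶ Y, s ≫ t = f := by
  refine ⟨fun h S s hs => ?_, fun h W g hg => ?_⟩
  · obtain ⟨W, g, k, hT⟩ := distinguished_cocone_triangle₁ s
    have hgs : g ≫ s = 0 := comp_distTriang_mor_zero₁₂ _ hT
    obtain ⟨t, ht⟩ := Triangle.yoneda_exact₂ _ hT f
      (h g fun _ => hs ((cancel_epi g).1 (by rw [hgs, comp_zero])))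
    exact ⟨t, ht.symm⟩
  · obtain ⟨S, s, k, hT⟩ := distinguished_cocone_triangle g
    have hgs : g ≫ s = 0 := comp_distTriang_mor_zero₁₂ _ hT
    obtain ⟨t, rfl⟩ := h s fun hs => hg <|
      have : Epi g := Triangle.epi₁ _ hT hs
      isSplitEpi_of_epi g
    rw [← Category.assoc, hgs, zero_comp]

theorem exists_mor₁_comp_eq_iff (T : Triangle C) (hT : T ∈ distTriang C) {W : C}
    (h : T.obj₁ ⟶ W) : (∃ g, T.mor₁ ≫ g = h) ↔ T.mor₃ ≫ h⟦(1 : ℤ)⟧' = 0 := by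
  constructor
  · rintro ⟨g, rfl⟩
    rw [Functor.map_comp, ← Category.assoc, comp_distTriang_mor_zero₃₁ _ hT, zero_comp]
  · intro hh
    obtain ⟨g, hg, -⟩ := complete_distinguished_triangle_morphism₂ T _ hT
      (contractible_distinguished W) h 0 (hh.trans zero_comp.symm)
    exact ⟨g, hg.trans (Category.comp_id h)⟩

theorem exists_comp_mor₂_eq_iff (T : Triangle C) (hT : T ∈ distTriang C) {W : C}
    (h : W ⟶ T.obj₃) : (∃ g, g ≫ T.mor₂ = h) ↔ h ≫ T.mor₃ = 0 := by
  constructor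
  · rintro ⟨g, rfl⟩
    rw [Category.assoc, comp_distTriang_mor_zero₂₃ _ hT, comp_zero]
  · intro hh
    obtain ⟨g, hg⟩ := Triangle.coyoneda_exact₃ _ hT h hh
    exact ⟨g, hg.symm⟩

theorem isLeftAlmostSplit_mor₁_iff (T : Triangle C) (hT : T ∈ distTriang C) (h₀ : T.mor₃ ≠ 0) :
    IsLeftAlmostSplit T.mor₁ ↔
      ∀ ⦃W : C⦄ (h : T.obj₁ ⟶ W), ¬ IsSplitMono h → T.mor₃ ≫ h⟦(1 : ℤ)⟧' = 0 := by
  simp only [IsLeftAlmostSplit, exists_mor₁_comp_eq_iff T hT, and_iff_right_iff_imp]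
  exact fun _ _ => h₀ (Triangle.mor₃_eq_zero_of_mono₁ _ hT inferInstance)

theorem isRightAlmostSplit_mor₂_iff (T : Triangle C) (hT : T ∈ distTriang C) (h₀ : T.mor₃ ≠ 0) :
    IsRightAlmostSplit T.mor₂ ↔
      ∀ ⦃W : C⦄ (h : W ⟶ T.obj₃), ¬ IsSplitEpi h → h ≫ T.mor₃ = 0 := by
  simp only [IsRightAlmostSplit, exists_comp_mor₂_eq_iff T hT, and_iff_right_iff_imp]
  exact fun _ _ => h₀ (Triangle.mor₃_eq_zero_of_epi₂ _ hT inferInstance)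

theorem forall_not_isSplitMono_comp_shift_eq_zero_iff :
    (∀ ⦃W : C⦄ (h : Y⟦(-1 : ℤ)⟧ ⟶ W), ¬ IsSplitMono h →
        (f ≫ (unshiftShiftIso Y).inv) ≫ h⟦(1 : ℤ)⟧' = 0) ↔
      ∀ ⦃Z : C⦄ (g : Y ⟶ Z), ¬ IsSplitMono g → f ≫ g = 0 := by
  refine ⟨fun H Z g hg => ?_, fun H W h hh => ?_⟩
  · have := H (g⟦(-1 : ℤ)⟧') fun _ => hg <|
      have : Mono g := (shiftFunctor C (-1 : ℤ)).mono_of_mono_map inferInstance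
      isSplitMono_of_mono g
    rw [Category.assoc, unshiftShiftIso_inv_naturality, ← Category.assoc] at this
    exact (cancel_mono (unshiftShiftIso Z).inv).1 (by rw [this, zero_comp])
  · rw [Category.assoc]
    refine H _ fun hs => hh ?_
    have : Mono (h⟦(1 : ℤ)⟧') := by
      have := mono_comp (unshiftShiftIso Y).hom ((unshiftShiftIso Y).inv ≫ h⟦(1 : ℤ)⟧')
      rwa [Iso.hom_inv_id_assoc] at this
    have : Mono h := (shiftFunctor C (1 : ℤ)).mono_of_mono_map this
    exact isSplitMono_of_mono h

end Pretriangulated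

end Paper

open Paper in
/-- Characterisations of almost split triangles: for `X`, `Y` with local
endomorphism rings, a nonzero `f : X ⟶ Y`, and a distinguished triangle
`Δ : Y⟦-1⟧ → E → X → Y` ending in `f`, the eleven conditions are equivalent. -/
theorem almostSplit_tfae
    {C : Type u} [Category.{v} C] [Preadditive C] [HasZeroObject C] [HasShift C ℤ]
    [∀ n : ℤ, (shiftFunctor C n).Additive] [Pretriangulated C]
    (X Y : C) [IsLocalRing (End X)] [IsLocalRing (End Y)]
    (f : X ⟶ Y) (hf : f ≠ 0)
    (E : C) (d : Y⟦(-1 : ℤ)⟧ ⟶ E) (e : E ⟶ X)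
    (hΔ : Triangle.mk d e (f ≫ (unshiftShiftIso Y).inv) ∈ distTriang C) :
    [ -- (i) Δ is an almost split triangle
      IsAlmostSplitTriangle (Triangle.mk d e (f ≫ (unshiftShiftIso Y).inv)),
      -- (ii) d is left almost split
      IsLeftAlmostSplit d,
      -- (iii) e is right almost split
      IsRightAlmostSplit e,
      -- (iv) gf = 0 whenever g is not a split monomorphism
      ∀ ⦃Z : C⦄ (g : Y ⟶ Z), ¬ IsSplitMono g → f ≫ g = 0,
      -- (v) fh = 0 whenever h is not a split epimorphism
      ∀ ⦃W : C⦄ (h : W ⟶ X), ¬ IsSplitEpi h → h ≫ f = 0,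
      -- (vi) every nonzero t : T ⟶ Y admits s : X ⟶ T with ts = f
      ∀ ⦃T : C⦄ (t : T ⟶ Y), t ≠ 0 → ∃ s : X ⟶ T, s ≫ t = f,
      -- (vii) every nonzero s : X ⟶ S admits t : S ⟶ Y with ts = f
      ∀ ⦃S : C⦄ (s : X ⟶ S), s ≠ 0 → ∃ t : S ⟶ Y, s ≫ t = f,
      -- (viii) non-degenerate composition and f ∘ rad End(X) = 0
      NondegComp X Y ∧ ∀ r : End X, r ∈ (⊥ : Ideal (End X)).jacobson → (r : X ⟶ X) ≫ f = 0,
      -- (ix) non-degenerate composition and rad End(Y) ∘ f = 0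
      NondegComp X Y ∧ ∀ r : End Y, r ∈ (⊥ : Ideal (End Y)).jacobson → f ≫ (r : Y ⟶ Y) = 0,
      -- (x) non-degenerate composition and every nonzero End(X)-submodule of Hom(X,Y)
      -- contains f
      NondegComp X Y ∧ ∀ S : AddSubgroup (X ⟶ Y),
        (∀ (r : X ⟶ X), ∀ g ∈ S, r ≫ g ∈ S) → S ≠ ⊥ → f ∈ S,
      -- (xi) non-degenerate composition and every nonzero End(Y)ᵒᵖ-submodule of Hom(X,Y)
      -- contains f
      NondegComp X Y ∧ ∀ S : AddSubgroup (X ⟶ Y),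
        (∀ (r : Y ⟶ Y), ∀ g ∈ S, g ≫ r ∈ S) → S ≠ ⊥ → f ∈ S ].TFAE := by
  have h₀ : (Triangle.mk d e (f ≫ (unshiftShiftIso Y).inv)).mor₃ ≠ 0 := fun h =>
    hf ((cancel_mono (unshiftShiftIso Y).inv).1 (h.trans zero_comp.symm))
  tfae_have 2 ↔ 4 :=
    (isLeftAlmostSplit_mor₁_iff _ hΔ h₀).trans forall_not_isSplitMono_comp_shift_eq_zero_iff
  tfae_have 3 ↔ 5 :=
    (isRightAlmostSplit_mor₂_iff _ hΔ h₀).trans <| forall₃_congr fun W (h : W ⟶ X) _ => by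
      change h ≫ f ≫ (unshiftShiftIso Y).inv = 0 ↔ _
      rw [← Category.assoc, Preadditive.IsIso.comp_right_eq_zero]
  tfae_have 4 ↔ 6 := forall_not_isSplitMono_comp_eq_zero_iff
  tfae_have 5 ↔ 7 := forall_not_isSplitEpi_comp_eq_zero_iff
  tfae_have 6 → 5 := fun H W h hh => by
    by_contra hne
    obtain ⟨s, hs⟩ := H _ hne
    exact hh (isSplitEpi_of_comp_comp_eq_self hf hs)
  tfae_have 7 → 4 := fun H Z g hg => by
    by_contra hne
    obtain ⟨t, ht⟩ := H _ hne
    exact hg (isSplitMono_of_comp_comp_eq_self hf ht)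
  tfae_have 1 → 2 := fun h => h.1
  tfae_have 2 → 1 := fun h =>
    ⟨h, tfae_3_iff_5.2 (tfae_6_to_5 (tfae_4_iff_6.1 (tfae_2_iff_4.1 h)))⟩
  tfae_have 5 → 8 := fun h =>
    ⟨nondegComp_of_forall_exists_comp_eq hf (tfae_4_iff_6.1 (tfae_7_to_4 (tfae_5_iff_7.1 h)))
      (tfae_5_iff_7.1 h), fun r hr => h r
      (isSplitEpi_end_iff_isUnit.not.2 (IsLocalRing.mem_jacobson_bot_iff_not_isUnit.1 hr))⟩
  tfae_have 8 → 5 := fun h _ _ hh => h.1.comp_eq_zero_of_not_isSplitEpi h.2 hh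
  tfae_have 4 → 9 := fun h =>
    ⟨nondegComp_of_forall_exists_comp_eq hf (tfae_4_iff_6.1 h)
      (tfae_5_iff_7.1 (tfae_6_to_5 (tfae_4_iff_6.1 h))), fun r hr => h r
      (isSplitMono_end_iff_isUnit.not.2 (IsLocalRing.mem_jacobson_bot_iff_not_isUnit.1 hr))⟩
  tfae_have 9 → 4 := fun h _ _ hg => h.1.comp_eq_zero_of_not_isSplitMono h.2 hg
  tfae_have 6 → 10 := fun h =>
    ⟨nondegComp_of_forall_exists_comp_eq hf h (tfae_5_iff_7.1 (tfae_6_to_5 h)), fun S hS hne => by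
      obtain ⟨g, hg, hg₀⟩ := S.bot_or_exists_ne_zero.resolve_left hne
      obtain ⟨s, rfl⟩ := h g hg₀
      exact hS s g hg⟩
  tfae_have 10 → 6 := fun h _ _ ht => h.1.exists_comp_eq_of_forall_mem_left h.2 ht
  tfae_have 7 → 11 := fun h =>
    ⟨nondegComp_of_forall_exists_comp_eq hf (tfae_4_iff_6.1 (tfae_7_to_4 h)) h, fun S hS hne => by
      obtain ⟨g, hg, hg₀⟩ := S.bot_or_exists_ne_zero.resolve_left hne
      obtain ⟨t, rfl⟩ := h g hg₀
      exact hS t g hg⟩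
  tfae_have 11 → 7 := fun h _ _ hs => h.1.exists_comp_eq_of_forall_mem_right h.2 hs
  tfae_finish
end
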